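/- Let p, q ≥ 1 be coprime integers and let A be a unital C*-algebra with no K₁-obstructions. Consider matrices over A indexed by (Fin p × Fin q), and let Z_{p,q}(A) = {f ∈ C([0,1], M_{pq}(A)) : there exists b ∈ M_q(A) with f(0)((i,j),(i′,j′)) = δ_{i,i′} b(j,j′) for all indices, and there exists a ∈ M_p(A) with f(1)((i,j),(i′,j′)) = a(i,i′) δ_{j,j′} for all indices}. Then Z_{p,q}(A) has stable rank one. -/

import Mathlib

noncomputable section

set_option maxHeartbeats 1000000

def StableRankOne (A : Type*) [NonUnitalCStarAlgebra A] : Prop :=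
  Dense {x : Unitization ℂ A | IsUnit x}

def K1Trivial (B : Type*) [NonUnitalCStarAlgebra B] : Prop :=
  ∀ n : ℕ, 0 < n → ∀ u : unitary (Matrix (Fin n) (Fin n) (Unitization ℂ B)),
    ∃ (k : ℕ) (h : Matrix.fromBlocks u.1 0 0
        (1 : Matrix (Fin k) (Fin k) (Unitization ℂ B)) ∈
        unitary (Matrix (Fin n ⊕ Fin k) (Fin n ⊕ Fin k) (Unitization ℂ B))),
      Joined (1 : unitary (Matrix (Fin n ⊕ Fin k) (Fin n ⊕ Fin k) (Unitization ℂ B)))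
        ⟨Matrix.fromBlocks u.1 0 0 1, h⟩

def NoK1Obstructions (A : Type*) [NonUnitalCStarAlgebra A] : Prop :=
  StableRankOne A ∧
    ∀ (B : NonUnitalStarSubalgebra ℂ A) [IsClosed (B : Set A)],
      (∀ b ∈ B, ∀ a : A, ∀ b' ∈ B, b * a * b' ∈ B) → K1Trivial B

open scoped unitInterval in
/-- The dimension-drop type condition defining `Z_{p,q}(A)` inside
`C([0,1], M_{pq}(A))`. -/
def DimDropCond (p q : ℕ) (A : Type*) [CStarAlgebra A]
    (f : C(unitInterval, Matrix (Fin p × Fin q) (Fin p × Fin q) A)) : Prop :=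
  (∃ b : Matrix (Fin q) (Fin q) A, ∀ (i i' : Fin p) (j j' : Fin q),
      f 0 (i, j) (i', j') = if i = i' then b j j' else 0) ∧
  (∃ a : Matrix (Fin p) (Fin p) A, ∀ (i i' : Fin p) (j j' : Fin q),
      f 1 (i, j) (i', j') = if j = j' then a i i' else 0)

/-- The column `(f, g)` can be moved to `(1, 0)` by an invertible `2 × 2` matrix. -/
def ColumnReducible {C : Type*} [Ring C] (f g : C) : Prop :=
  ∃ E : (Matrix (Fin 2) (Fin 2) C)ˣ, E.1.mulVec ![f, g] = ![1, 0]

/-- The column `(f, g)` is left invertible. -/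
def LeftUnimodular {C : Type*} [Ring C] (f g : C) : Prop :=
  ∃ y w : C, y * f + w * g = 1

namespace ColumnReducible

variable {C : Type*} [Ring C] {f g f' g' : C}

theorem of_mulVec (G : (Matrix (Fin 2) (Fin 2) C)ˣ) (h : G.1.mulVec ![f, g] = ![f', g'])
    (H : ColumnReducible f' g') : ColumnReducible f g := by
  obtain ⟨E, hE⟩ := H
  refine ⟨E * G, ?_⟩
  rw [Units.val_mul, ← Matrix.mulVec_mulVec, h, hE]

theorem swap (H : ColumnReducible g f) : ColumnReducible f g := by
  refine of_mulVec ⟨!![0, 1; 1, 0], !![0, 1; 1, 0], ?_, ?_⟩ ?_ H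
  · simp [Matrix.one_fin_two]
  · simp [Matrix.one_fin_two]
  · ext i; fin_cases i <;> simp [Matrix.mulVec, dotProduct]

theorem of_add_mul (q : C) (H : ColumnReducible f (g + q * f)) : ColumnReducible f g := by
  refine of_mulVec ⟨!![1, 0; q, 1], !![1, 0; -q, 1], ?_, ?_⟩ ?_ H
  · simp [Matrix.one_fin_two]
  · simp [Matrix.one_fin_two]
  · ext i; fin_cases i <;> simp [Matrix.mulVec, dotProduct, add_comm]

theorem of_unit_mul (e : Cˣ) (H : ColumnReducible (e * f) g) : ColumnReducible f g := by
  refine of_mulVec ⟨!![e.1, 0; 0, 1], !![e⁻¹.1, 0; 0, 1], ?_, ?_⟩ ?_ H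
  · simp [Matrix.one_fin_two]
  · simp [Matrix.one_fin_two]
  · ext i; fin_cases i <;> simp [Matrix.mulVec, dotProduct]

theorem zero_left {y : C} (h : y * g = 1) : ColumnReducible 0 g := by
  refine swap (of_add_mul y (swap ?_))
  rw [zero_add, h]
  refine of_add_mul (-g) ?_
  simp only [mul_one, add_neg_cancel]
  exact ⟨1, by simp⟩

end ColumnReducible

theorem LeftUnimodular.swap {C : Type*} [Ring C] {f g : C} (h : LeftUnimodular f g) :
    LeftUnimodular g f := by
  obtain ⟨y, w, h⟩ := h
  exact ⟨w, y, by rw [add_comm, h]⟩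

theorem LeftUnimodular.add_mul {C : Type*} [Ring C] {f g : C} (h : LeftUnimodular f g) (q : C) :
    LeftUnimodular f (g + q * f) := by
  obtain ⟨y, w, h⟩ := h
  exact ⟨y - w * q, w, by rw [← h]; noncomm_ring⟩

open Topology Filter in
theorem LeftUnimodular.eventually {C : Type*} [NormedRing C] [CompleteSpace C] {f g : C}
    (h : LeftUnimodular f g) :
    ∀ᶠ f' in 𝓝 f, LeftUnimodular f' g ∧ (ColumnReducible f' g → ColumnReducible f g) := by
  obtain ⟨y, w, h⟩ := h
  have h1 : Tendsto (fun f' => y * f' + w * g) (𝓝 f) (𝓝 1) := by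
    have : Continuous (fun f' => y * f' + w * g) := by fun_prop
    simpa [h] using this.tendsto f
  have h2 : ∀ᶠ f' in 𝓝 f, IsUnit (y * f' + w * g) :=
    h1.eventually (Units.isOpen.mem_nhds isUnit_one)
  have h3 : Tendsto (fun f' => 1 - (f' - f) * Ring.inverse (y * f' + w * g) * y) (𝓝 f) (𝓝 1) := by
    have h4 : Tendsto (fun f' => Ring.inverse (y * f' + w * g)) (𝓝 f) (𝓝 1) := by
      have := NormedRing.inverse_continuousAt (1 : Cˣ)
      have h5 := this.tendsto.comp h1
      simpa [Function.comp_def] using h5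
    have h6 : Tendsto (fun f' => f' - f) (𝓝 f) (𝓝 0) := by
      have : Continuous (fun f' => f' - f) := by fun_prop
      simpa using this.tendsto f
    simpa using tendsto_const_nhds.sub ((h6.mul h4).mul_const y)
  have h4 : ∀ᶠ f' in 𝓝 f, IsUnit (1 - (f' - f) * Ring.inverse (y * f' + w * g) * y) :=
    h3.eventually (Units.isOpen.mem_nhds isUnit_one)
  filter_upwards [h2, h4] with f' h5 h6
  have h7 : Ring.inverse (y * f' + w * g) * (y * f' + w * g) = 1 := Ring.inverse_mul_cancel _ h5
  set e := Ring.inverse (y * f' + w * g)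
  refine ⟨⟨e * y, e * w, by rw [← h7]; noncomm_ring⟩, fun H => ?_⟩
  obtain ⟨v, hv⟩ := h6
  have h8 : f = v.1 * f' + (-((f' - f) * e * w)) * g := by
    have : f = f' - (f' - f) * (e * (y * f' + w * g)) := by rw [h7]; noncomm_ring
    rw [hv]
    nth_rewrite 1 [this]
    noncomm_ring
  refine ColumnReducible.swap (ColumnReducible.of_add_mul ((f' - f) * e * w) ?_)
  refine ColumnReducible.swap (ColumnReducible.of_unit_mul v⁻¹ ?_)
  have : v⁻¹.1 * (f + (f' - f) * e * w * g) = f' := by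
    nth_rewrite 1 [h8]
    have : v.1 * f' + (-((f' - f) * e * w)) * g + (f' - f) * e * w * g = v.1 * f' := by
      noncomm_ring
    rw [this, ← mul_assoc]; simp
  rw [this]
  exact H

/-- `f` is a polynomial of degree less than `m` in `z` with coefficients in the image of `c`. -/
def IsPolyLT {S C : Type*} [Ring S] [Ring C] (c : S →+* C) (z : C) : ℕ → C → Prop
  | 0, f => f = 0
  | m + 1, f => ∃ f₀ s, IsPolyLT c z m f₀ ∧ f = f₀ + c s * z ^ m

namespace IsPolyLT

variable {S C : Type*} [Ring S] [Ring C] {c : S →+* C} {z : C}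

theorem zero (m : ℕ) : IsPolyLT c z m 0 := by
  induction m with
  | zero => rfl
  | succ m ih => exact ⟨0, 0, ih, by simp⟩

theorem succ {m : ℕ} {f : C} (h : IsPolyLT c z m f) : IsPolyLT c z (m + 1) f :=
  ⟨f, 0, h, by simp⟩

theorem mono {m n : ℕ} {f : C} (h : IsPolyLT c z m f) (hmn : m ≤ n) : IsPolyLT c z n f := by
  induction n, hmn using Nat.le_induction with
  | base => exact h
  | succ n _ ih => exact ih.succ

theorem add {m : ℕ} {f g : C} (hf : IsPolyLT c z m f) (hg : IsPolyLT c z m g) :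
    IsPolyLT c z m (f + g) := by
  induction m generalizing f g with
  | zero => rw [IsPolyLT] at *; simp [hf, hg]
  | succ m ih =>
    obtain ⟨f₀, s, hf, rfl⟩ := hf
    obtain ⟨g₀, t, hg, rfl⟩ := hg
    refine ⟨f₀ + g₀, s + t, ih hf hg, ?_⟩
    rw [map_add]
    noncomm_ring

theorem const_mul {m : ℕ} {f : C} (hf : IsPolyLT c z m f) (s : S) :
    IsPolyLT c z m (c s * f) := by
  induction m generalizing f with
  | zero => rw [IsPolyLT] at *; simp [hf]
  | succ m ih =>
    obtain ⟨f₀, t, hf, rfl⟩ := hf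
    refine ⟨c s * f₀, s * t, ih hf, ?_⟩
    rw [map_mul]
    noncomm_ring

theorem pow_mul (hz : ∀ x, Commute z x) {m : ℕ} {f : C} (hf : IsPolyLT c z m f) (k : ℕ) :
    IsPolyLT c z (m + k) (z ^ k * f) := by
  induction m generalizing f with
  | zero => rw [IsPolyLT] at hf; rw [hf, mul_zero]; exact zero _
  | succ m ih =>
    obtain ⟨f₀, t, hf, rfl⟩ := hf
    rw [Nat.add_right_comm]
    refine ⟨z ^ k * f₀, t, ih hf, ?_⟩
    rw [mul_add, ← mul_assoc, ((hz (c t)).pow_left k).eq, mul_assoc, ← pow_add, add_comm k]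

end IsPolyLT

open Topology Filter in
/-- The Euclidean algorithm for polynomial columns over a Banach algebra with dense units. -/
theorem columnReducible_of_isPolyLT {S C : Type*} [NormedRing S] [NormedRing C] [CompleteSpace C]
    (hS : Dense {s : S | IsUnit s}) {c : S →+* C} (hc : Continuous c) {z : C}
    (hz : ∀ x, Commute z x) (N m n : ℕ) (hN : m + n ≤ N) (f g : C) (hf : IsPolyLT c z m f)
    (hg : IsPolyLT c z n g) (h : LeftUnimodular f g) : ColumnReducible f g := by
  induction N generalizing m n f g with
  | zero =>
    obtain rfl : m = 0 := by omega
    rw [IsPolyLT] at hf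
    subst hf
    obtain ⟨y, w, h⟩ := h
    exact ColumnReducible.zero_left (y := w) (by simpa using h)
  | succ N ih =>
    wlog hmn : m ≤ n generalizing m n f g
    · exact ColumnReducible.swap (this n m (by omega) g f hg hf h.swap (by omega))
    obtain _ | m := m
    · rw [IsPolyLT] at hf
      subst hf
      obtain ⟨y, w, h⟩ := h
      exact ColumnReducible.zero_left (y := w) (by simpa using h)
    obtain _ | n := n
    · omega
    obtain ⟨f₀, a, hf, rfl⟩ := hf
    obtain ⟨g₀, b, hg, rfl⟩ := hg
    have h1 : Tendsto (fun s => f₀ + c s * z ^ m) (𝓝 a) (𝓝 (f₀ + c a * z ^ m)) := by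
      have : Continuous (fun s => f₀ + c s * z ^ m) := by fun_prop
      exact this.tendsto a
    have h2 := h1.eventually h.eventually
    obtain ⟨_, ⟨u, rfl⟩, hu1, hu2⟩ := hS.inter_nhds_nonempty h2
    refine hu2 ?_
    refine ColumnReducible.of_add_mul (-(c (b * u⁻¹.1) * z ^ (n - m))) ?_
    refine ih (m + 1) n (by omega) _ _ ⟨f₀, u, hf, rfl⟩ ?_ (hu1.add_mul _)
    have h3 : g₀ + c b * z ^ n + -(c (b * u⁻¹.1) * z ^ (n - m)) * (f₀ + c u * z ^ m)
        = g₀ + c (-(b * u⁻¹.1)) * (z ^ (n - m) * f₀) := by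
      have : c (b * u⁻¹.1) * z ^ (n - m) * (c u * z ^ m) = c b * z ^ n := by
        rw [← mul_assoc, mul_assoc _ _ (c u), ((hz (c u)).pow_left _).eq, ← mul_assoc, ← map_mul,
          mul_assoc, mul_assoc, ← pow_add, Nat.sub_add_cancel (by omega)]
        simp
      rw [neg_mul, mul_add, this, map_neg]
      noncomm_ring
    rw [h3]
    refine hg.add (IsPolyLT.const_mul ?_ _)
    have := IsPolyLT.pow_mul hz hf (n - m)
    rwa [Nat.add_sub_cancel' (by omega)] at this

open Topology Filter in
theorem columnReducible_of_dense_laurent {S C : Type*} [NormedRing S] [NormedRing C]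
    [CompleteSpace C] (hS : Dense {s : S | IsUnit s}) {c : S →+* C} (hc : Continuous c) (z : Cˣ)
    (hz : ∀ x, Commute z.1 x) (hd : Dense {f : C | ∃ N m, IsPolyLT c z.1 m (z.1 ^ N * f)})
    {f g : C} (h : LeftUnimodular f g) : ColumnReducible f g := by
  obtain ⟨f', ⟨N, m, hf⟩, hf1, hf2⟩ := hd.inter_nhds_nonempty h.eventually
  refine hf2 (ColumnReducible.swap ?_)
  obtain ⟨g', ⟨N', n, hg⟩, hg1, hg2⟩ := hd.inter_nhds_nonempty hf1.swap.eventually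
  refine hg2 ?_
  refine ColumnReducible.of_unit_mul (z ^ (N + N')) (ColumnReducible.swap
    (ColumnReducible.of_unit_mul (z ^ (N + N')) ?_))
  simp only [Units.val_pow_eq_pow_val]
  refine columnReducible_of_isPolyLT hS hc hz _ (m + N') (n + N) le_rfl _ _ ?_ ?_ ?_
  · rw [add_comm N, pow_add, mul_assoc]; exact hf.pow_mul hz _
  · rw [pow_add, mul_assoc]; exact hg.pow_mul hz _
  · obtain ⟨y, w, h⟩ := hg1.swap
    refine ⟨y * (z⁻¹ ^ (N + N')).1, w * (z⁻¹ ^ (N + N')).1, ?_⟩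
    have : (z⁻¹ ^ (N + N')).1 * z.1 ^ (N + N') = 1 := by
      rw [← Units.val_pow_eq_pow_val, ← Units.val_mul]; simp
    rw [mul_assoc, mul_assoc, ← mul_assoc _ _ f', ← mul_assoc _ _ g', this]
    simpa using h

/-- The elements `z⁻ᴺ f` with `f` a polynomial in `z`. -/
def laurentSubgroup {S C : Type*} [Ring S] [Ring C] (c : S →+* C) (z : C)
    (hz : ∀ x, Commute z x) : AddSubgroup C where
  carrier := {f | ∃ N m, IsPolyLT c z m (z ^ N * f)}
  zero_mem' := ⟨0, 0, by rw [mul_zero]; exact IsPolyLT.zero 0⟩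
  add_mem' := by
    rintro f g ⟨N, m, hf⟩ ⟨N', n, hg⟩
    refine ⟨N + N', (m + N') + (n + N), ?_⟩
    rw [mul_add]
    refine IsPolyLT.add ?_ ?_
    · rw [add_comm N, pow_add, mul_assoc]
      exact (hf.pow_mul hz _).mono (by omega)
    · rw [pow_add, mul_assoc]
      exact (hg.pow_mul hz _).mono (by omega)
  neg_mem' := by
    rintro f ⟨N, m, hf⟩
    refine ⟨N, m, ?_⟩
    simpa using hf.const_mul (-1)

section Circle

variable {S : Type*} [NormedRing S] [NormedAlgebra ℂ S]

/-- Constant functions on the circle. -/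
def circleConst (S : Type*) [NormedRing S] : S →+* C(AddCircle (1 : ℝ), S) where
  toFun s := ContinuousMap.const _ s
  map_one' := rfl
  map_mul' _ _ := rfl
  map_zero' := rfl
  map_add' _ _ := rfl

/-- The function `φ • s` for a scalar function `φ`. -/
def circleSMul (s : S) (φ : C(AddCircle (1 : ℝ), ℂ)) : C(AddCircle (1 : ℝ), S) :=
  (⟨fun w : ℂ => w • s, by fun_prop⟩ : C(ℂ, S)).comp φ

theorem circleSMul_apply (s : S) (φ : C(AddCircle (1 : ℝ), ℂ)) (x : AddCircle (1 : ℝ)) :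
    circleSMul s φ x = φ x • s := rfl

theorem continuous_circleSMul (s : S) : Continuous (circleSMul s) :=
  ContinuousMap.continuous_postcomp _

/-- The unit `e^{2πix}` of `C(𝕋, S)`. -/
def circleUnit (S : Type*) [NormedRing S] [NormedAlgebra ℂ S] : C(AddCircle (1 : ℝ), S)ˣ where
  val := circleSMul 1 (fourier 1)
  inv := circleSMul 1 (fourier (-1))
  val_inv := by
    ext x
    simp only [ContinuousMap.mul_apply, circleSMul_apply, smul_mul_smul_comm, mul_one,
      ← fourier_add]
    simp
  inv_val := by
    ext x
    simp only [ContinuousMap.mul_apply, circleSMul_apply, smul_mul_smul_comm, mul_one,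
      ← fourier_add]
    simp

theorem circleUnit_commute (f : C(AddCircle (1 : ℝ), S)) : Commute (circleUnit S).1 f := by
  ext x
  simp [circleUnit, circleSMul_apply]

theorem circleUnit_pow_apply (N : ℕ) (x : AddCircle (1 : ℝ)) :
    ((circleUnit S).1 ^ N) x = (fourier N x : ℂ) • (1 : S) := by
  induction N with
  | zero => simp
  | succ N ih =>
    rw [pow_succ, ContinuousMap.mul_apply, ih]
    rw [circleUnit, circleSMul_apply, smul_mul_smul_comm, one_mul, ← fourier_add, Nat.cast_add,
      Nat.cast_one]

theorem circleSMul_fourier_mem (s : S) (n : ℤ) :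
    circleSMul s (fourier n) ∈ laurentSubgroup (circleConst S) (circleUnit S).1
      circleUnit_commute := by
  have key : ∀ N : ℕ, IsPolyLT (circleConst S) (circleUnit S).1 (N + 1)
      (circleSMul s (fourier N)) := by
    intro N
    refine ⟨0, s, IsPolyLT.zero _, ?_⟩
    ext x
    rw [ContinuousMap.add_apply, ContinuousMap.mul_apply, circleUnit_pow_apply, circleSMul_apply]
    have : circleConst S s x = s := rfl
    simp [this]
  obtain ⟨k, rfl | rfl⟩ := n.eq_nat_or_neg
  · exact ⟨0, k + 1, by simpa using key k⟩
  · refine ⟨k, 1, ?_⟩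
    have : (circleUnit S).1 ^ k * circleSMul s (fourier (-(k : ℤ)))
        = circleSMul s (fourier (0 : ℕ)) := by
      ext x
      rw [ContinuousMap.mul_apply, circleUnit_pow_apply, circleSMul_apply, circleSMul_apply,
        smul_mul_smul_comm, one_mul, ← fourier_add]
      simp
    rw [this]
    exact key 0

theorem circleSMul_mem_closure (s : S) (φ : C(AddCircle (1 : ℝ), ℂ)) :
    circleSMul s φ ∈ (laurentSubgroup (circleConst S) (circleUnit S).1
      circleUnit_commute).topologicalClosure := by
  have h1 : ∀ φ ∈ Submodule.span ℂ (Set.range (fourier (T := 1))), ∀ s : S,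
      circleSMul s φ ∈ laurentSubgroup (circleConst S) (circleUnit S).1 circleUnit_commute := by
    intro φ hφ
    induction hφ using Submodule.span_induction with
    | mem x h => obtain ⟨n, rfl⟩ := h; exact fun s => circleSMul_fourier_mem s n
    | zero =>
      intro s
      have : circleSMul s (0 : C(AddCircle (1 : ℝ), ℂ)) = 0 := by ext x; simp [circleSMul_apply]
      rw [this]
      exact zero_mem _
    | add x y _ _ hx hy =>
      intro s
      have : circleSMul s (x + y) = circleSMul s x + circleSMul s y := by
        ext t; simp [circleSMul_apply, add_smul]
      rw [this]
      exact add_mem (hx s) (hy s)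
    | smul a x _ hx =>
      intro s
      have : circleSMul s (a • x) = circleSMul (a • s) x := by
        ext t; simp [circleSMul_apply, smul_smul, mul_comm]
      rw [this]
      exact hx (a • s)
  have h2 : φ ∈ closure (Submodule.span ℂ (Set.range (fourier (T := 1))) :
      Set C(AddCircle (1 : ℝ), ℂ)) := by
    have : φ ∈ (Submodule.span ℂ (Set.range (fourier (T := 1)))).topologicalClosure := by
      rw [span_fourier_closure_eq_top]; trivial
    exact this
  exact map_mem_closure (continuous_circleSMul s) h2 (fun φ hφ => h1 φ hφ s)

/-- A loop on the unit interval descends to the circle. -/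
theorem exists_circle_lift {X : Type*} [TopologicalSpace X] (f : C(unitInterval, X))
    (hf : f 0 = f 1) : ∃ F : C(AddCircle (1 : ℝ), X),
    ∀ t : unitInterval, F ((t : ℝ) : AddCircle (1 : ℝ)) = f t := by
  have h0 : Set.IccExtend zero_le_one f 0 = f 0 := Set.IccExtend_left _ _
  have h1 : Set.IccExtend zero_le_one f 1 = f 1 := Set.IccExtend_right _ _
  refine ⟨⟨AddCircle.liftIco 1 0 (Set.IccExtend zero_le_one f),
    AddCircle.liftIco_zero_continuous (by rw [h0, h1, hf])
      (f.continuous.Icc_extend').continuousOn⟩, fun t => ?_⟩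
  by_cases ht : (t : ℝ) = 1
  · have : t = 1 := Subtype.ext ht
    subst this
    have h : ((1 : ℝ) : AddCircle (1 : ℝ)) = ((0 : ℝ) : AddCircle (1 : ℝ)) := by simp
    change AddCircle.liftIco 1 0 (Set.IccExtend zero_le_one f) ((1 : ℝ) : AddCircle (1 : ℝ)) = _
    rw [h, AddCircle.liftIco_zero_coe_apply (by simp), h0, hf]
  · change AddCircle.liftIco 1 0 (Set.IccExtend zero_le_one f) ((t : ℝ) : AddCircle (1 : ℝ)) = _
    rw [AddCircle.liftIco_zero_coe_apply ⟨t.2.1, lt_of_le_of_ne t.2.2 ht⟩]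
    exact Set.IccExtend_val _ _ _

theorem exists_unitInterval_coe (x : AddCircle (1 : ℝ)) :
    ∃ t : unitInterval, ((t : ℝ) : AddCircle (1 : ℝ)) = x := by
  have := AddCircle.coe_image_Ico_eq (1 : ℝ) 0
  obtain ⟨t, ht, rfl⟩ := this.symm ▸ Set.mem_univ x
  exact ⟨⟨t, ht.1, by have := ht.2; linarith⟩, rfl⟩

theorem dense_laurentSubgroup :
    Dense (laurentSubgroup (circleConst S) (circleUnit S).1 circleUnit_commute :
      Set C(AddCircle (1 : ℝ), S)) := by
  intro F
  set L := laurentSubgroup (circleConst S) (circleUnit S).1 circleUnit_commute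
  let f : C(unitInterval, S) := ⟨fun t => F ((t : ℝ) : AddCircle (1 : ℝ)), by
    exact F.continuous.comp ((AddCircle.continuous_mk' 1).comp continuous_subtype_val)⟩
  have h10 : ((1 : ℝ) : AddCircle (1 : ℝ)) = 0 := AddCircle.coe_period 1
  have hf : f 0 = f 1 := by simp [f, h10]
  suffices F ∈ closure (L.topologicalClosure : Set C(AddCircle (1 : ℝ), S)) by
    rwa [L.isClosed_topologicalClosure.closure_eq] at this
  rw [Metric.mem_closure_iff]
  intro ε hε
  let _ : NormedSpace ℝ S := NormedSpace.restrictScalars ℝ ℂ S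
  have : IsScalarTower ℝ ℂ S := by infer_instance
  have hB := bernsteinApproximation_uniform f
  obtain ⟨n, hn⟩ := (hB.eventually (Metric.ball_mem_nhds f hε)).exists
  have hlift : ∀ k : Fin (n + 1), ∃ G ∈ L.topologicalClosure, ∀ t : unitInterval,
      G ((t : ℝ) : AddCircle (1 : ℝ)) = bernstein n k t • (f (bernstein.z k) - f 0) := by
    intro k
    by_cases hk : f (bernstein.z k) = f 0
    · exact ⟨0, zero_mem _, fun t => by simp [hk]⟩
    · have e0 : bernstein n k 0 = bernstein n k 1 := by
        have hk0 : (k : ℕ) ≠ 0 := by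
          intro h; apply hk; congr 1; ext; simp [bernstein.z, h]
        have hk1 : (k : ℕ) ≠ n := by
          intro h; apply hk; rw [hf]; congr 1; ext
          have : (n : ℝ) ≠ 0 := by
            rw [← h]; exact_mod_cast hk0
          simp [bernstein.z, h, this]
        have : n - (k : ℕ) ≠ 0 := by have := k.2; omega
        simp [bernstein_apply, hk0, this]
      obtain ⟨Φ, hΦ⟩ := exists_circle_lift
        (⟨fun t => (bernstein n k t : ℂ), by fun_prop⟩ : C(unitInterval, ℂ)) (by simp [e0])
      refine ⟨circleSMul (f (bernstein.z k) - f 0) Φ, circleSMul_mem_closure _ _, fun t => ?_⟩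
      rw [circleSMul_apply, hΦ]
      exact Complex.coe_smul _ _
  choose G hG1 hG2 using hlift
  refine ⟨circleSMul (f 0) 1 + ∑ k, G k, add_mem (circleSMul_mem_closure _ _)
    (sum_mem fun k _ => hG1 k), ?_⟩
  rw [ContinuousMap.dist_lt_iff hε]
  intro x
  obtain ⟨t, rfl⟩ := exists_unitInterval_coe x
  have h1 : (circleSMul (f 0) 1 + ∑ k, G k) ((t : ℝ) : AddCircle (1 : ℝ)) =
      bernsteinApproximation n f t := by
    rw [bernsteinApproximation.apply, ContinuousMap.add_apply, ContinuousMap.sum_apply]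
    simp only [hG2, smul_sub, Finset.sum_sub_distrib, ← Finset.sum_smul, bernstein.probability,
      circleSMul_apply]
    simp
  rw [h1, dist_comm]
  exact (ContinuousMap.dist_lt_iff hε).1 hn t

end Circle

section Stabilization

theorem continuous_matrix_inverse {X ι S : Type*} [TopologicalSpace X] [Fintype ι] [DecidableEq ι]
    [NormedRing S] [CompleteSpace S] {γ : X → Matrix ι ι S} (hγ : Continuous γ)
    (h : ∀ t, IsUnit (γ t)) : Continuous fun t => Ring.inverse (γ t) := by
  let nr : NormedRing (Matrix ι ι S) := Matrix.linftyOpNormedRing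
  have hcs : @CompleteSpace (Matrix ι ι S) nr.toMetricSpace.toUniformSpace :=
    Matrix.instCompleteSpace ι ι S
  have key : @Continuous X (Matrix ι ι S) _ nr.toMetricSpace.toUniformSpace.toTopologicalSpace
      fun t => Ring.inverse (γ t) := by
    rw [continuous_iff_continuousAt]
    intro t
    obtain ⟨v, hv⟩ := h t
    have h1 := NormedRing.inverse_continuousAt v
    rw [hv] at h1
    exact ContinuousAt.comp (f := γ) h1 (Continuous.continuousAt hγ)
  exact key

theorem JoinedIn.of_matrix_fin_two {S : Type*} [NormedRing S] [NormedAlgebra ℂ S]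
    [CompleteSpace S] (hS : Dense {s : S | IsUnit s}) {u : S}
    (h : JoinedIn {M : Matrix (Fin 2) (Fin 2) S | IsUnit M} 1 !![1, 0; 0, u]) :
    JoinedIn {s : S | IsUnit s} 1 u := by
  obtain ⟨γ, hγ⟩ := h
  let δ : unitInterval → Matrix (Fin 2) (Fin 2) S := fun t => Ring.inverse (γ t)
  have hδ : Continuous δ := continuous_matrix_inverse γ.continuous hγ
  have h1 : ∀ t, γ t * δ t = 1 := fun t => Ring.mul_inverse_cancel _ (hγ t)
  have h2 : ∀ t, δ t * γ t = 1 := fun t => Ring.inverse_mul_cancel _ (hγ t)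
  have hent : ∀ i j, Continuous fun t => γ t i j := fun i j => γ.continuous.matrix_elem i j
  have hent' : ∀ i j, Continuous fun t => δ t i j := fun i j => hδ.matrix_elem i j
  have δ0 : δ 0 = 1 := by simp [δ]
  have h11 := h1 1
  rw [γ.target] at h11
  obtain ⟨F, hF⟩ := exists_circle_lift (⟨fun t => γ t 0 0, hent 0 0⟩ : C(unitInterval, S)) (by simp)
  obtain ⟨G, hG⟩ := exists_circle_lift (⟨fun t => γ t 1 0, hent 1 0⟩ : C(unitInterval, S)) (by simp)
  obtain ⟨Y, hY⟩ := exists_circle_lift (⟨fun t => δ t 0 0, hent' 0 0⟩ : C(unitInterval, S)) (by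
    have := congrFun (congrFun h11 0) 0
    simp [Matrix.mul_apply, Fin.sum_univ_two] at this
    simp [δ0, this])
  obtain ⟨W, hW⟩ := exists_circle_lift (⟨fun t => δ t 0 1, hent' 0 1⟩ : C(unitInterval, S)) (by
    have := congrFun (congrFun h11 0) 1
    simp [Matrix.mul_apply, Fin.sum_univ_two] at this
    simp [δ0, this])
  have hFG : LeftUnimodular F G := by
    refine ⟨Y, W, ?_⟩
    ext x
    obtain ⟨t, rfl⟩ := exists_unitInterval_coe x
    have := congrFun (congrFun (h2 t) 0) 0
    simp only [Matrix.mul_apply, Fin.sum_univ_two] at this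
    simp [hF, hG, hY, hW, this]
  have hc : Continuous (circleConst S) := ContinuousMap.continuous_const'
  obtain ⟨E, hE⟩ := columnReducible_of_dense_laurent hS hc (circleUnit S) circleUnit_commute
    dense_laurentSubgroup hFG
  let ev : AddCircle (1 : ℝ) → (Matrix (Fin 2) (Fin 2) C(AddCircle (1 : ℝ), S) →+*
      Matrix (Fin 2) (Fin 2) S) := fun x =>
    ((Pi.evalRingHom _ x).comp ContinuousMap.coeFnRingHom).mapMatrix
  have hev : ∀ x M i j, ev x M i j = M i j x := fun _ _ _ _ => rfl
  let X : unitInterval → Matrix (Fin 2) (Fin 2) S := fun t => ev (t : ℝ) E.1 * γ t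
  let Z : unitInterval → Matrix (Fin 2) (Fin 2) S := fun t => δ t * ev (t : ℝ) E⁻¹.1
  have hXZ : ∀ t, X t * Z t = 1 := fun t => by
    simp only [X, Z]
    rw [mul_assoc, ← mul_assoc (γ t), h1, one_mul, ← map_mul]
    simp
  have hZX : ∀ t, Z t * X t = 1 := fun t => by
    simp only [X, Z]
    rw [mul_assoc, ← mul_assoc _ _ (γ t), ← map_mul]
    simp [h2]
  have hX0 : ∀ t, X t 0 0 = 1 := fun t => by
    have := congrArg (fun f : C(AddCircle (1 : ℝ), S) => f (t : ℝ)) (congrFun hE 0)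
    simpa [Matrix.mulVec, dotProduct, Fin.sum_univ_two, X, Matrix.mul_apply, hev, hF, hG]
      using this
  have hX1 : ∀ t, X t 1 0 = 0 := fun t => by
    have := congrArg (fun f : C(AddCircle (1 : ℝ), S) => f (t : ℝ)) (congrFun hE 1)
    simpa [Matrix.mulVec, dotProduct, Fin.sum_univ_two, X, Matrix.mul_apply, hev, hF, hG]
      using this
  have hZ1 : ∀ t, Z t 1 0 = 0 := fun t => by
    have := congrFun (congrFun (hZX t) 1) 0
    simpa [Matrix.mul_apply, Fin.sum_univ_two, hX0, hX1] using this
  have hs1 : ∀ t, X t 1 1 * Z t 1 1 = 1 := fun t => by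
    have := congrFun (congrFun (hXZ t) 1) 1
    simpa [Matrix.mul_apply, Fin.sum_univ_two, hX1] using this
  have hs2 : ∀ t, Z t 1 1 * X t 1 1 = 1 := fun t => by
    have := congrFun (congrFun (hZX t) 1) 1
    simpa [Matrix.mul_apply, Fin.sum_univ_two, hZ1] using this
  have hXc : Continuous fun t => X t 1 1 := by
    simp only [X, Matrix.mul_apply, hev]
    refine continuous_finsetSum _ fun j _ => ?_
    exact ((E.1 1 j).continuous.comp
      ((AddCircle.continuous_mk' 1).comp continuous_subtype_val)).mul (hent _ _)
  have hend : X 1 1 1 = X 0 1 1 * u := by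
    have h10 : ((1 : ℝ) : AddCircle (1 : ℝ)) = 0 := AddCircle.coe_period 1
    simp [X, Matrix.mul_apply, hev, Fin.sum_univ_two, h10]
  refine ⟨⟨⟨fun t => Z 0 1 1 * X t 1 1, by fun_prop⟩, hs2 0, ?_⟩, fun t => ?_⟩
  · change Z 0 1 1 * X 1 1 1 = u
    rw [hend, ← mul_assoc, hs2, one_mul]
  · exact (isUnit_iff_exists.2 ⟨_, hs2 0, hs1 0⟩).mul
      (isUnit_iff_exists.2 ⟨_, hs1 t, hs2 t⟩)

end Stabilization

section Dense

theorem isUnit_reindex {ι κ S : Type*} [Fintype ι] [DecidableEq ι] [Fintype κ] [DecidableEq κ]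
    [Ring S] (e : ι ≃ κ) {M : Matrix ι ι S} (h : IsUnit M) : IsUnit (M.submatrix e.symm e.symm) :=
  h.map (Matrix.reindexAlgEquiv ℤ S e)

theorem Matrix.dense_isUnit_of_equiv {ι κ S : Type*} [Fintype ι] [DecidableEq ι] [Fintype κ]
    [DecidableEq κ] [Ring S] [TopologicalSpace S] (e : ι ≃ κ)
    (h : Dense {M : Matrix ι ι S | IsUnit M}) : Dense {M : Matrix κ κ S | IsUnit M} := by
  have hc : Continuous fun M : Matrix ι ι S => M.submatrix e.symm e.symm :=
    continuous_id.matrix_submatrix _ _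
  have hs : Function.Surjective fun M : Matrix ι ι S => M.submatrix e.symm e.symm :=
    fun M => ⟨M.submatrix e e, by ext; simp⟩
  refine (hs.denseRange.dense_image hc h).mono ?_
  rintro _ ⟨M, hM, rfl⟩
  exact isUnit_reindex e hM

theorem Matrix.isUnit_fromBlocks_schur {m n S : Type*} [Fintype m] [DecidableEq m] [Fintype n]
    [DecidableEq n] [Ring S] (a : (Matrix m m S)ˣ) (b : Matrix m n S) (c : Matrix n m S)
    (s : (Matrix n n S)ˣ) :
    IsUnit (Matrix.fromBlocks a.1 b c (s.1 + c * (a⁻¹.1 * b))) := by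
  have h1 : IsUnit (Matrix.fromBlocks (1 : Matrix m m S) 0 (c * a⁻¹.1) (1 : Matrix n n S)) :=
    isUnit_iff_exists.2 ⟨Matrix.fromBlocks 1 0 (-(c * a⁻¹.1)) 1,
      by simp [Matrix.fromBlocks_multiply], by simp [Matrix.fromBlocks_multiply]⟩
  have h2 : IsUnit (Matrix.fromBlocks (1 : Matrix m m S) (a⁻¹.1 * b) 0 (1 : Matrix n n S)) :=
    isUnit_iff_exists.2 ⟨Matrix.fromBlocks 1 (-(a⁻¹.1 * b)) 0 1,
      by simp [Matrix.fromBlocks_multiply], by simp [Matrix.fromBlocks_multiply]⟩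
  have h3 : IsUnit (Matrix.fromBlocks a.1 0 0 s.1) :=
    isUnit_iff_exists.2 ⟨Matrix.fromBlocks a⁻¹.1 0 0 s⁻¹.1,
      by simp [Matrix.fromBlocks_multiply], by simp [Matrix.fromBlocks_multiply]⟩
  convert (h1.mul h3).mul h2 using 1
  simp only [Matrix.fromBlocks_multiply, Matrix.one_mul, Matrix.mul_one, Matrix.zero_mul,
    Matrix.mul_zero, add_zero, zero_add, Matrix.mul_assoc]
  rw [← Matrix.mul_assoc a.1, Units.mul_inv, Units.inv_mul]
  simp [add_comm]

open Topology Filter in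
theorem Matrix.dense_isUnit_sum {m n S : Type*} [Fintype m] [DecidableEq m] [Fintype n]
    [DecidableEq n] [Ring S] [TopologicalSpace S] [IsTopologicalRing S]
    (hm : Dense {M : Matrix m m S | IsUnit M}) (hn : Dense {M : Matrix n n S | IsUnit M}) :
    Dense {M : Matrix (m ⊕ n) (m ⊕ n) S | IsUnit M} := by
  intro M
  rw [mem_closure_iff_nhds]
  intro U hU
  rw [← Matrix.fromBlocks_toBlocks M] at hU
  have hc1 : Continuous fun a : Matrix m m S =>
      Matrix.fromBlocks a M.toBlocks₁₂ M.toBlocks₂₁ M.toBlocks₂₂ :=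
    continuous_id.matrix_fromBlocks continuous_const continuous_const continuous_const
  have h1 := eventually_eventually_nhds.2 hU
  obtain ⟨_, ⟨a, rfl⟩, ha⟩ := hm.inter_nhds_nonempty (hc1.continuousAt.eventually h1)
  have hc2 : Continuous fun s : Matrix n n S =>
      Matrix.fromBlocks a.1 M.toBlocks₁₂ M.toBlocks₂₁
        (s + M.toBlocks₂₁ * (a⁻¹.1 * M.toBlocks₁₂)) :=
    continuous_const.matrix_fromBlocks continuous_const continuous_const (by fun_prop)
  have h2 := hc2.continuousAt (x := M.toBlocks₂₂ - M.toBlocks₂₁ * (a⁻¹.1 * M.toBlocks₁₂))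
  rw [ContinuousAt, sub_add_cancel] at h2
  obtain ⟨_, ⟨s, rfl⟩, hs⟩ := hn.inter_nhds_nonempty (h2.eventually ha)
  exact ⟨_, hs, Matrix.isUnit_fromBlocks_schur a _ _ s⟩

theorem Matrix.dense_isUnit {ι S : Type*} [Fintype ι] [DecidableEq ι] [Ring S] [TopologicalSpace S]
    [IsTopologicalRing S] (hS : Dense {s : S | IsUnit s}) :
    Dense {M : Matrix ι ι S | IsUnit M} := by
  have h1 : Dense {M : Matrix (Fin 1) (Fin 1) S | IsUnit M} := by
    let f : S → Matrix (Fin 1) (Fin 1) S := fun s => Matrix.scalar (Fin 1) s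
    have hc : Continuous f := by
      refine continuous_matrix fun i j => ?_
      simp only [f, Matrix.scalar_apply, Matrix.diagonal_apply]
      split_ifs <;> fun_prop
    have hs : Function.Surjective f := fun M => ⟨M 0 0, by
      ext i j
      rw [Subsingleton.elim i 0, Subsingleton.elim j 0]; simp [f]⟩
    refine (hs.denseRange.dense_image hc hS).mono ?_
    rintro _ ⟨s, hs, rfl⟩
    exact IsUnit.map (Matrix.scalar (Fin 1)) hs
  have h2 : ∀ n : ℕ, Dense {M : Matrix (Fin n) (Fin n) S | IsUnit M} := by
    intro n
    induction n with
    | zero =>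
      intro M
      refine subset_closure ?_
      have : M = 1 := Subsingleton.elim _ _
      rw [this]; exact isUnit_one
    | succ n ih => exact Matrix.dense_isUnit_of_equiv finSumFinEquiv (Matrix.dense_isUnit_sum ih h1)
  exact Matrix.dense_isUnit_of_equiv (Fintype.equivFin ι).symm (h2 _)

end Dense

section Descent

/-- A path of invertible matrices from `1` to `diag(u, 1, …, 1)` yields a path of invertible
elements from `1` to `u`. -/
def UnitDescent (ι S : Type*) [Fintype ι] [DecidableEq ι] [Ring S] [TopologicalSpace S] : Prop :=
  ∀ (i : ι) (u : S), JoinedIn {M : Matrix ι ι S | IsUnit M} 1 (1 + Matrix.single i i (u - 1)) →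
    JoinedIn {s : S | IsUnit s} 1 u

theorem JoinedIn.map_of_continuous {X Y : Type*} [TopologicalSpace X] [TopologicalSpace Y]
    {s : Set X} {t : Set Y} {x y : X} (h : JoinedIn s x y) {f : X → Y} (hf : Continuous f)
    (hst : ∀ x ∈ s, f x ∈ t) : JoinedIn t (f x) (f y) := by
  obtain ⟨γ, hγ⟩ := h
  exact ⟨γ.map hf, fun u => hst _ (hγ u)⟩

theorem UnitDescent.of_equiv {ι κ S : Type*} [Fintype ι] [DecidableEq ι] [Fintype κ]
    [DecidableEq κ] [Ring S] [TopologicalSpace S] (e : ι ≃ κ) (h : UnitDescent ι S) :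
    UnitDescent κ S := by
  intro i u H
  refine h (e.symm i) u ?_
  have hc : Continuous fun M : Matrix κ κ S => M.submatrix e e :=
    continuous_id.matrix_submatrix _ _
  convert H.map_of_continuous hc (t := {M : Matrix ι ι S | IsUnit M})
    (fun M hM => isUnit_reindex e.symm hM) using 1
  · simp
  · simp [Matrix.submatrix_add]

theorem UnitDescent.of_sum {ι κ S : Type*} [Fintype ι] [DecidableEq ι] [Fintype κ]
    [DecidableEq κ] [Ring S] [TopologicalSpace S] (h : UnitDescent (ι ⊕ κ) S) :
    UnitDescent ι S := by
  intro i u H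
  refine h (Sum.inl i) u ?_
  have hc : Continuous fun M : Matrix ι ι S => Matrix.fromBlocks M 0 0 (1 : Matrix κ κ S) :=
    continuous_id.matrix_fromBlocks continuous_const continuous_const continuous_const
  convert H.map_of_continuous hc (t := {M : Matrix (ι ⊕ κ) (ι ⊕ κ) S | IsUnit M}) ?_ using 1
  · simp
  · ext a b
    rcases a with a | a <;> rcases b with b | b <;>
      simp [Matrix.single_apply, Matrix.one_apply]
  · rintro M ⟨v, rfl⟩
    exact isUnit_iff_exists.2 ⟨Matrix.fromBlocks v⁻¹.1 0 0 1,
      by simp [Matrix.fromBlocks_multiply], by simp [Matrix.fromBlocks_multiply]⟩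

theorem UnitDescent.prod {ι κ S : Type*} [Fintype ι] [DecidableEq ι] [Fintype κ]
    [DecidableEq κ] [Ring S] [TopologicalSpace S] (h : UnitDescent κ S)
    (h' : UnitDescent ι (Matrix κ κ S)) : UnitDescent (ι × κ) S := by
  rintro ⟨i, k⟩ u H
  refine h k u (h' i _ ?_)
  have hc : Continuous fun M : Matrix (ι × κ) (ι × κ) S => (Matrix.compRingEquiv ι κ S).symm M :=
    continuous_matrix fun a b => continuous_matrix fun c d => continuous_id.matrix_elem _ _
  convert H.map_of_continuous hc (t := {M : Matrix ι ι (Matrix κ κ S) | IsUnit M})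
    (fun M hM => hM.map (Matrix.compRingEquiv ι κ S).symm) using 1
  · exact (map_one (Matrix.compRingEquiv ι κ S).symm).symm
  · ext a b c d
    change _ = (1 + Matrix.single (i, k) (i, k) (u - 1) : Matrix (ι × κ) (ι × κ) S) (a, c) (b, d)
    by_cases hab : a = b <;> by_cases hcd : c = d <;> by_cases hia : i = a <;>
      by_cases hib : i = b <;> by_cases hkc : k = c <;> by_cases hkd : k = d <;>
      simp_all

theorem unitDescent_fin_two {S : Type*} [NormedRing S] [NormedAlgebra ℂ S] [CompleteSpace S]
    (hS : Dense {s : S | IsUnit s}) : UnitDescent (Fin 2) S := by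
  intro i u H
  refine JoinedIn.of_matrix_fin_two hS ?_
  have hc : Continuous fun M : Matrix (Fin 2) (Fin 2) S =>
      M.submatrix (Equiv.swap i 1) (Equiv.swap i 1) := continuous_id.matrix_submatrix _ _
  convert H.map_of_continuous hc (t := {M : Matrix (Fin 2) (Fin 2) S | IsUnit M})
    (fun M hM => isUnit_reindex (Equiv.swap i 1) hM) using 1
  · simp
  · ext a b
    fin_cases i <;> fin_cases a <;> fin_cases b <;> simp

theorem unitDescent {ι S : Type*} [Fintype ι] [DecidableEq ι] [NormedRing S] [NormedAlgebra ℂ S]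
    [CompleteSpace S] (hS : Dense {s : S | IsUnit s}) : UnitDescent ι S := by
  have h1 : ∀ m : ℕ, UnitDescent (Fin (2 ^ m)) S := by
    intro m
    induction m with
    | zero =>
      intro i u H
      have hc : Continuous fun M : Matrix (Fin (2 ^ 0)) (Fin (2 ^ 0)) S => M i i :=
        continuous_id.matrix_elem i i
      convert H.map_of_continuous hc (t := {s : S | IsUnit s}) ?_ using 1
      · simp
      · simp
      · rintro M hM
        obtain ⟨N, h1, h2⟩ := isUnit_iff_exists.1 hM
        have : Subsingleton (Fin (2 ^ 0)) := by rw [pow_zero]; infer_instance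
        have huniv : (Finset.univ : Finset (Fin (2 ^ 0))) = {i} :=
          Finset.eq_singleton_iff_unique_mem.2 ⟨Finset.mem_univ _, fun _ _ => Subsingleton.elim _ _⟩
        refine isUnit_iff_exists.2 ⟨N i i, ?_, ?_⟩
        · have h3 := congrFun (congrFun h1 i) i
          rwa [Matrix.mul_apply, huniv, Finset.sum_singleton, Matrix.one_apply_eq] at h3
        · have h3 := congrFun (congrFun h2 i) i
          rwa [Matrix.mul_apply, huniv, Finset.sum_singleton, Matrix.one_apply_eq] at h3
    | succ m ih =>
      let nr : NormedRing (Matrix (Fin (2 ^ m)) (Fin (2 ^ m)) S) := Matrix.linftyOpNormedRing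
      let na : NormedAlgebra ℂ (Matrix (Fin (2 ^ m)) (Fin (2 ^ m)) S) :=
        Matrix.linftyOpNormedAlgebra
      have hcs : @CompleteSpace (Matrix (Fin (2 ^ m)) (Fin (2 ^ m)) S)
        nr.toMetricSpace.toUniformSpace := Matrix.instCompleteSpace _ _ S
      have hd : Dense {M : Matrix (Fin (2 ^ m)) (Fin (2 ^ m)) S | IsUnit M} :=
        Matrix.dense_isUnit hS
      have h2 := @unitDescent_fin_two _ nr na hcs hd
      have h3 := ih.prod h2
      exact h3.of_equiv (Fintype.equivFinOfCardEq (by simp [pow_succ, mul_comm]))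
  have h2 : Fintype.card ι ≤ 2 ^ Fintype.card ι := Nat.lt_two_pow_self.le
  obtain ⟨k, hk⟩ := Nat.exists_eq_add_of_le h2
  refine UnitDescent.of_sum (κ := Fin k) ((h1 (Fintype.card ι)).of_equiv ?_)
  exact (Fintype.equivFinOfCardEq (by simp [hk])).symm

end Descent

section Polar

theorem exists_unitary_mul_of_isUnit {A : Type*} [CStarAlgebra A] {x : A} (hx : IsUnit x) :
    ∃ v ∈ unitary A, ∃ p : A, IsSelfAdjoint p ∧ (∀ r ∈ spectrum ℝ p, 0 < r) ∧ x = v * p := by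
  let := CStarAlgebra.spectralOrder A
  have := CStarAlgebra.spectralOrderedRing A
  have hpp : CFC.abs x * CFC.abs x = star x * x := CFC.abs_mul_abs x
  have hp0 : 0 ≤ CFC.abs x := CFC.abs_nonneg x
  have hps : IsSelfAdjoint (CFC.abs x) := hp0.isSelfAdjoint
  have hpu : IsUnit (CFC.abs x) := by
    have : IsUnit (CFC.abs x * CFC.abs x) := hpp ▸ hx.star.mul hx
    exact ((Commute.refl _).isUnit_mul_iff.1 this).1
  obtain ⟨p, hp⟩ := hpu
  rw [← hp] at hpp hp0 hps
  have hinv : star p⁻¹.1 = p⁻¹.1 := by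
    have h1 : star p = p := Units.ext hps
    rw [← Units.coe_star, star_inv, h1]
  refine ⟨x * p⁻¹.1, ?_, p.1, hps, fun r hr => ?_, by simp [mul_assoc]⟩
  · have h1 : star (x * p⁻¹.1) * (x * p⁻¹.1) = 1 := by
      rw [star_mul, hinv, mul_assoc, ← mul_assoc (star x), ← hpp]
      simp [mul_assoc]
    obtain ⟨w, hw⟩ : IsUnit (x * p⁻¹.1) := hx.mul p⁻¹.isUnit
    refine Unitary.mem_iff.2 ⟨h1, ?_⟩
    rw [← hw] at h1 ⊢
    rw [← Units.inv_eq_of_mul_eq_one_left h1, Units.mul_inv]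
  · refine lt_of_le_of_ne (spectrum_nonneg_of_nonneg hp0 hr) ?_
    rintro rfl
    exact spectrum.zero_notMem ℝ p.isUnit hr

theorem joinedIn_isUnit_one_of_spectrum_pos {A : Type*} [CStarAlgebra A] {p : A}
    (hp : ∀ r ∈ spectrum ℝ p, 0 < r) : JoinedIn {x : A | IsUnit x} 1 p := by
  refine JoinedIn.ofLine (f := fun t : ℝ => (1 - t) • (1 : A) + t • p)
    (by fun_prop) (by simp) (by simp) ?_
  rintro _ ⟨t, ⟨h0, h1⟩, rfl⟩
  rcases h0.eq_or_lt with rfl | h0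
  · simp
  have h : -((1 - t) / t) ∉ spectrum ℝ p := fun h => by
    have := hp _ h
    have : 0 ≤ (1 - t) / t := div_nonneg (by linarith) h0.le
    linarith
  rw [spectrum.notMem_iff] at h
  have h2 := (h.neg).smul (Units.mk0 t h0.ne')
  change IsUnit ((1 - t) • (1 : A) + t • p)
  convert h2 using 1
  rw [Units.smul_def, Units.val_mk0, Algebra.algebraMap_eq_smul_one, neg_sub, smul_sub, smul_smul,
    mul_neg, mul_div_cancel₀ _ h0.ne', neg_smul, sub_neg_eq_add, add_comm]

end Polar

section Hereditary

theorem K1Trivial.joinedIn_one {B : Type*} [NonUnitalCStarAlgebra B] (hK : K1Trivial B)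
    (hd : Dense {x : Unitization ℂ B | IsUnit x}) {x : Unitization ℂ B} (hx : IsUnit x) :
    JoinedIn {x : Unitization ℂ B | IsUnit x} 1 x := by
  obtain ⟨v, hv, p, -, hp, rfl⟩ := exists_unitary_mul_of_isUnit hx
  have hv1 : JoinedIn {x : Unitization ℂ B | IsUnit x} 1 v := by
    have hu : (Matrix.diagonal fun _ => v : Matrix (Fin 1) (Fin 1) (Unitization ℂ B)) ∈
        unitary (Matrix (Fin 1) (Fin 1) (Unitization ℂ B)) := by
      obtain ⟨h1, h2⟩ := Unitary.mem_iff.1 hv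
      rw [Unitary.mem_iff, Matrix.star_eq_conjTranspose, Matrix.diagonal_conjTranspose]
      simp only [Matrix.diagonal_mul_diagonal, Pi.star_apply, h1, h2]
      simp
    obtain ⟨k, h, ⟨γ⟩⟩ := hK 1 one_pos ⟨_, hu⟩
    refine unitDescent (ι := Fin 1 ⊕ Fin k) hd (Sum.inl 0) v ?_
    refine ⟨⟨⟨fun t => (γ t).1, ?_⟩, ?_, ?_⟩, fun t => ?_⟩
    · exact continuous_subtype_val.comp γ.continuous
    · simp
    · simp only [Path.target]
      refine Matrix.ext fun a b => ?_
      rcases a with a | a <;> rcases b with b | b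
      · simp [Subsingleton.elim a 0, Subsingleton.elim b 0]
      · simp
      · simp
      · simp [Matrix.one_apply]
    · exact Unitary.isUnit_coe (U := γ t)
  have hp1 := joinedIn_isUnit_one_of_spectrum_pos hp
  refine hv1.trans ?_
  have := hp1.map_of_continuous (f := fun y => v * y) (by fun_prop)
    (t := {x : Unitization ℂ B | IsUnit x}) (fun y hy => (Unitary.isUnit_coe (U := ⟨v, hv⟩)).mul hy)
  simpa using this

variable {A : Type*} [CStarAlgebra A]

/-- The hereditary subalgebra generated by a self-adjoint element `k`, the closure of `kAk`. -/
def hereditaryClosure (k : A) (hk : IsSelfAdjoint k) : NonUnitalStarSubalgebra ℂ A :=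
  NonUnitalStarSubalgebra.topologicalClosure
    { carrier := Set.range fun a => k * a * k
      add_mem' := by
        rintro _ _ ⟨a, rfl⟩ ⟨b, rfl⟩
        exact ⟨a + b, by simp [mul_add, add_mul]⟩
      zero_mem' := ⟨0, by simp⟩
      mul_mem' := by
        rintro _ _ ⟨a, rfl⟩ ⟨b, rfl⟩
        exact ⟨a * k * k * b, by simp [mul_assoc]⟩
      smul_mem' := by
        rintro c _ ⟨a, rfl⟩
        exact ⟨c • a, by simp⟩
      star_mem' := by
        rintro _ ⟨a, rfl⟩
        exact ⟨star a, by simp [hk.star_eq, mul_assoc]⟩ }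

variable {k : A} (hk : IsSelfAdjoint k)

theorem isClosed_hereditaryClosure : IsClosed (hereditaryClosure k hk : Set A) :=
  isClosed_closure

theorem mul_mul_mem_hereditaryClosure (a : A) : k * a * k ∈ hereditaryClosure k hk :=
  subset_closure ⟨a, rfl⟩

theorem hereditaryClosure_hereditary {b : A} (hb : b ∈ hereditaryClosure k hk) (a : A) {b' : A}
    (hb' : b' ∈ hereditaryClosure k hk) : b * a * b' ∈ hereditaryClosure k hk := by
  refine map_mem_closure₂ (f := fun b b' => b * a * b') (by fun_prop) hb hb' ?_
  rintro _ ⟨c, rfl⟩ _ ⟨d, rfl⟩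
  exact ⟨c * k * a * k * d, by simp [mul_assoc]⟩

theorem mul_eq_of_mem_hereditaryClosure {l b : A} (hl : l * k = k)
    (hb : b ∈ hereditaryClosure k hk) : l * b = b := by
  have hc : IsClosed {b : A | l * b = b} := isClosed_eq (by fun_prop) (by fun_prop)
  refine closure_minimal ?_ hc hb
  rintro _ ⟨a, rfl⟩
  simp [← mul_assoc, hl]

theorem isUnit_one_add_mul_comm {R : Type*} [Ring R] {a b : R} (h : IsUnit (1 + a * b)) :
    IsUnit (1 + b * a) := by
  obtain ⟨c, h1, h2⟩ := isUnit_iff_exists.1 h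
  refine isUnit_iff_exists.2 ⟨1 - b * c * a, ?_, ?_⟩
  · have : (1 + b * a) * (1 - b * c * a) = 1 + b * a - b * ((1 + a * b) * c) * a := by noncomm_ring
    rw [this, h1]; simp
  · have : (1 - b * c * a) * (1 + b * a) = 1 + b * a - b * (c * (1 + a * b)) * a := by noncomm_ring
    rw [this, h2]; simp

/-- The canonical unital homomorphism from the unitization of a subalgebra to the algebra. -/
def unitizationMap (B : NonUnitalStarSubalgebra ℂ A) : Unitization ℂ B →⋆ₐ[ℂ] A :=
  Unitization.starLift (NonUnitalStarSubalgebraClass.subtype B)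

theorem unitizationMap_apply (B : NonUnitalStarSubalgebra ℂ A)
    (x : Unitization ℂ B) : unitizationMap B x = algebraMap ℂ A x.fst + (x.snd : A) := by
  rfl

theorem StableRankOne.dense_isUnit (hA : StableRankOne A) : Dense {x : A | IsUnit x} := by
  let φ : Unitization ℂ A →⋆ₐ[ℂ] A := Unitization.starLift (NonUnitalStarAlgHom.id ℂ A)
  have hφ : ∀ x, φ x = algebraMap ℂ A x.fst + x.snd := fun x => rfl
  have hs : Function.Surjective φ := fun a => ⟨(a : Unitization ℂ A), by simp [hφ]⟩
  have hc : Continuous φ := by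
    change Continuous fun x : Unitization ℂ A => algebraMap ℂ A x.fst + x.snd
    exact ((algebraMapCLM ℂ A).continuous.comp Unitization.continuous_fst).add
      Unitization.continuous_snd
  refine (hs.denseRange.dense_image hc hA).mono ?_
  rintro _ ⟨x, hx, rfl⟩
  exact hx.map φ

theorem one_add_inr_mul_one_add_inr {B : Type*} [NonUnitalCStarAlgebra B] {b c : B}
    (h : b + c + b * c = 0) : (1 + (b : Unitization ℂ B)) * (1 + (c : Unitization ℂ B)) = 1 := by
  have h7 := congrArg (fun b : B => (b : Unitization ℂ B)) h
  simp only [Unitization.inr_add, Unitization.inr_mul, Unitization.inr_zero] at h7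
  rw [show (1 + (b : Unitization ℂ B)) * (1 + (c : Unitization ℂ B)) = 1 + (b + c + b * c) by
    noncomm_ring, h7, add_zero]

theorem isUnit_one_add_inr {B : NonUnitalStarSubalgebra ℂ A} [IsClosed (B : Set A)]
    (hB : ∀ b ∈ B, ∀ a : A, ∀ b' ∈ B, b * a * b' ∈ B) {b : B} (hb : IsUnit (1 + (b : A))) :
    IsUnit (1 + (b : Unitization ℂ B)) := by
  obtain ⟨c, h1, h2⟩ := isUnit_iff_exists.1 hb
  have h3 : c = 1 - c * b := by rw [mul_add, mul_one] at h2; exact eq_sub_of_add_eq h2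
  have h4 : c = 1 - b * c := by rw [add_mul, one_mul] at h1; exact eq_sub_of_add_eq h1
  obtain ⟨d, hd⟩ : ∃ d : B, c = 1 + (d : A) := by
    refine ⟨⟨-(b : A) + b * c * b, B.add_mem (neg_mem b.2) (hB _ b.2 _ _ b.2)⟩, ?_⟩
    nth_rewrite 1 [h4, h3]
    noncomm_ring
  rw [hd] at h1 h2
  refine isUnit_iff_exists.2 ⟨1 + (d : Unitization ℂ B), one_add_inr_mul_one_add_inr ?_,
    one_add_inr_mul_one_add_inr ?_⟩
  · refine Subtype.ext ?_
    change (b : A) + d + b * d = 0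
    rw [← sub_eq_zero.2 h1]; noncomm_ring
  · refine Subtype.ext ?_
    change (d : A) + b + d * b = 0
    rw [← sub_eq_zero.2 h2]; noncomm_ring

open Topology Filter in
theorem dense_isUnit_one_add_mul (hd : Dense {x : A | IsUnit x}) (c : A) :
    Dense {a : A | IsUnit (1 + a * c)} := by
  intro a
  rw [mem_closure_iff_nhds]
  intro U hU
  have h1 : Tendsto (fun y : A => y - a * c) (𝓝 (1 + a * c)) (𝓝 1) := by
    have : Continuous fun y : A => y - a * c := by fun_prop
    simpa using this.tendsto (1 + a * c)
  have h2 : Tendsto (fun y : A => Ring.inverse (y - a * c) * a) (𝓝 (1 + a * c)) (𝓝 a) := by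
    have h := (NormedRing.inverse_continuousAt (1 : Aˣ)).tendsto
    rw [Units.val_one, Ring.inverse_one] at h
    simpa using (h.comp h1).mul_const a
  have h3 : ∀ᶠ y in 𝓝 (1 + a * c), IsUnit (y - a * c) :=
    h1.eventually (Units.isOpen.mem_nhds isUnit_one)
  obtain ⟨y, hy, hyU, hyu⟩ := hd.inter_nhds_nonempty ((h2.eventually hU).and h3)
  refine ⟨_, hyU, ?_⟩
  obtain ⟨w, hw⟩ := hyu
  have h4 : 1 + Ring.inverse (y - a * c) * a * c = Ring.inverse (y - a * c) * y := by
    rw [← hw, Ring.inverse_unit, eq_add_of_sub_eq hw.symm, mul_add, Units.inv_mul, mul_assoc]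
  rw [Set.mem_ofPred_eq, h4, ← hw, Ring.inverse_unit]
  exact w⁻¹.isUnit.mul hy

instance : IsClosed (hereditaryClosure k hk : Set A) := isClosed_hereditaryClosure hk

theorem dense_isUnit_unitization_hereditaryClosure (hd : Dense {x : A | IsUnit x}) :
    Dense {x : Unitization ℂ (hereditaryClosure k hk) | IsUnit x} := by
  have hB : ∀ b ∈ hereditaryClosure k hk, ∀ a : A, ∀ b' ∈ hereditaryClosure k hk,
      b * a * b' ∈ hereditaryClosure k hk := fun _ hb a _ hb' =>
    hereditaryClosure_hereditary hk hb a hb'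
  let κ : A → hereditaryClosure k hk := fun a => ⟨k * a * k, mul_mul_mem_hereditaryClosure hk a⟩
  have hκ : Continuous κ := Continuous.subtype_mk (by fun_prop) _
  have hκd : DenseRange κ := by
    rw [DenseRange, Subtype.dense_iff]
    intro x hx
    rw [← Set.range_comp]
    exact hx
  have h1 : ∀ a : A, 1 + (κ a : Unitization ℂ (hereditaryClosure k hk)) ∈
      closure {x : Unitization ℂ (hereditaryClosure k hk) | IsUnit x} := by
    intro a
    have hc : Continuous fun a : A => 1 + (κ a : Unitization ℂ (hereditaryClosure k hk)) :=
      continuous_const.add (Unitization.continuous_inr.comp hκ)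
    refine map_mem_closure
      (f := fun a : A => 1 + (κ a : Unitization ℂ (hereditaryClosure k hk))) hc
      (dense_isUnit_one_add_mul hd (k * k) a) fun c hu => ?_
    refine isUnit_one_add_inr hB ?_
    have h2 : IsUnit (1 + (c * k) * k) := by simpa [mul_assoc] using hu
    have h3 := isUnit_one_add_mul_comm h2
    simpa [κ, mul_assoc] using h3
  have hsurj : Function.Surjective fun x : ℂ × hereditaryClosure k hk =>
      (algebraMap ℂ (Unitization ℂ (hereditaryClosure k hk)) x.1 + (x.2 : Unitization ℂ _)) :=
    fun x => ⟨(x.fst, x.snd), Unitization.inl_fst_add_inr_snd_eq x⟩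
  have hcont : Continuous fun x : ℂ × hereditaryClosure k hk =>
      (algebraMap ℂ (Unitization ℂ (hereditaryClosure k hk)) x.1 + (x.2 : Unitization ℂ _)) :=
    ((algebraMapCLM ℂ _).continuous.comp continuous_fst).add
      (Unitization.continuous_inr.comp continuous_snd)
  have h2 := hsurj.denseRange.dense_image hcont ((dense_compl_singleton (0 : ℂ)).prod hκd)
  rw [← dense_closure]
  refine h2.mono ?_
  rintro _ ⟨⟨c, _⟩, ⟨hc, a, rfl⟩, rfl⟩
  have hc0 : c ≠ 0 := hc
  have h3 : algebraMap ℂ (Unitization ℂ (hereditaryClosure k hk)) c + (κ a : Unitization ℂ _) =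
      c • (1 + (κ (c⁻¹ • a) : Unitization ℂ (hereditaryClosure k hk))) := by
    have : κ (c⁻¹ • a) = c⁻¹ • κ a := Subtype.ext (by simp [κ])
    rw [this, smul_add, Unitization.inr_smul, smul_smul, mul_inv_cancel₀ hc0, one_smul,
      Algebra.algebraMap_eq_smul_one]
  change algebraMap ℂ (Unitization ℂ (hereditaryClosure k hk)) c + (κ a : Unitization ℂ _) ∈ _
  rw [h3]
  refine map_mem_closure (continuous_const_smul c) (h1 _) fun x hx => ?_
  exact IsUnit.smul (Units.mk0 c hc0) hx

theorem NoK1Obstructions.joinedIn_one (hA : NoK1Obstructions A) {M : A} (hM : IsUnit M)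
    (hMB : M - 1 ∈ hereditaryClosure k hk) :
    JoinedIn {x : A | IsUnit x ∧ x - 1 ∈ hereditaryClosure k hk} 1 M := by
  have hB : ∀ b ∈ hereditaryClosure k hk, ∀ a : A, ∀ b' ∈ hereditaryClosure k hk,
      b * a * b' ∈ hereditaryClosure k hk := fun _ hb a _ hb' =>
    hereditaryClosure_hereditary hk hb a hb'
  have hK := hA.2 (hereditaryClosure k hk) hB
  have hd := dense_isUnit_unitization_hereditaryClosure hk hA.1.dense_isUnit
  have hu : IsUnit (1 + ((⟨M - 1, hMB⟩ : hereditaryClosure k hk) :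
      Unitization ℂ (hereditaryClosure k hk))) := isUnit_one_add_inr hB (by simpa using hM)
  obtain ⟨γ, hγ⟩ := hK.joinedIn_one hd hu
  have hne : ∀ t, (γ t).fst ≠ 0 := fun t => by
    have := (hγ t).map (Unitization.fstHom ℂ (hereditaryClosure k hk))
    exact this.ne_zero
  refine ⟨⟨⟨fun t => 1 + (γ t).fst⁻¹ • ((γ t).snd : A), ?_⟩, ?_, ?_⟩,
    fun t => ?_⟩
  · refine continuous_const.add (Continuous.smul ?_ (continuous_subtype_val.comp ?_))
    · exact (Unitization.continuous_fst.comp γ.continuous).inv₀ hne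
    · exact Unitization.continuous_snd.comp γ.continuous
  · simp
  · simp
  · refine ⟨?_, by simpa using SMulMemClass.smul_mem _ (γ t).snd.2⟩
    have h1 := (hγ t).map (unitizationMap (hereditaryClosure k hk))
    rw [unitizationMap_apply] at h1
    have h2 := IsUnit.smul (Units.mk0 _ (inv_ne_zero (hne t))) h1
    rw [Units.smul_def, Units.val_mk0, smul_add, Algebra.algebraMap_eq_smul_one, smul_smul,
      inv_mul_cancel₀ (hne t), one_smul] at h2
    exact h2

end Hereditary

section Cutoff

/-- The function equal to `1` for `t ≤ (c - 1) * η`, to `0` for `t ≥ c * η`, and affine between. -/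
def ramp (c η t : ℝ) : ℝ := max 0 (min 1 (c - t / η))

theorem continuous_ramp (c η : ℝ) : Continuous (ramp c η) := by
  unfold ramp; fun_prop

theorem ramp_nonneg (c η t : ℝ) : 0 ≤ ramp c η t := le_max_left _ _

theorem ramp_le_one (c η t : ℝ) : ramp c η t ≤ 1 := max_le zero_le_one (min_le_left _ _)

theorem abs_ramp_le_one (c η t : ℝ) : |ramp c η t| ≤ 1 :=
  abs_le.2 ⟨by linarith [ramp_nonneg c η t], ramp_le_one c η t⟩

theorem ramp_eq_one {c η t : ℝ} (hη : 0 < η) (h : t ≤ (c - 1) * η) : ramp c η t = 1 := by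
  have : t / η ≤ c - 1 := (div_le_iff₀ hη).2 h
  rw [ramp, min_eq_left (by linarith), max_eq_right zero_le_one]

theorem ramp_eq_zero {c η t : ℝ} (hη : 0 < η) (h : c * η ≤ t) : ramp c η t = 0 := by
  have : c ≤ t / η := (le_div_iff₀ hη).2 h
  exact max_eq_left ((min_le_right _ _).trans (by linarith))

theorem ramp_mul_ramp_succ {η : ℝ} (hη : 0 < η) (c t : ℝ) :
    ramp c η t * ramp (c + 1) η t = ramp c η t := by
  rcases le_total t (c * η) with h | h
  · rw [ramp_eq_one (c := c + 1) hη (by simpa using h), mul_one]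
  · rw [ramp_eq_zero hη h, zero_mul]

theorem le_add_mul_ramp {η t : ℝ} (hη : 0 < η) (ht : 0 ≤ t) : η ≤ t + η * ramp 2 η t := by
  rcases le_total t η with h | h
  · rw [ramp_eq_one hη (by linarith)]; linarith
  · nlinarith [ramp_nonneg 2 η t]

variable {A : Type*} [CStarAlgebra A]

theorem exists_cutoffs {a : A} (ha : IsSelfAdjoint a) (hpos : ∀ r ∈ spectrum ℝ a, 0 < r) {η : ℝ}
    (hη : 0 < η) : ∃ h k l n : A, IsSelfAdjoint k ∧ ‖h‖ ≤ 1 ∧ ‖k‖ ≤ 1 ∧ ‖1 - k‖ ≤ 1 ∧ ‖l‖ ≤ 1 ∧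
      h * k = h ∧ l * k = k ∧ (a + η • h) * n = 1 ∧ n * (a + η • h) = 1 ∧ ‖n‖ ≤ η⁻¹ ∧
      (1 - k) * (n * h) = 0 ∧ ‖(a + η • h) * l‖ ≤ 5 * η := by
  have hr : ∀ c, ContinuousOn (ramp c η) (spectrum ℝ a) := fun c =>
    (continuous_ramp c η).continuousOn
  have hm : a + η • cfc (ramp 2 η) a = cfc (fun t => t + η * ramp 2 η t) a := by
    rw [cfc_add a (fun t => t) (fun t => η * ramp 2 η t), cfc_id' ℝ a, cfc_const_mul η (ramp 2 η) a]
  have hmc : ContinuousOn (fun t => t + η * ramp 2 η t) (spectrum ℝ a) :=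
    (continuous_id.add (continuous_const.mul (continuous_ramp 2 η))).continuousOn
  have hm0 : ∀ t ∈ spectrum ℝ a, t + η * ramp 2 η t ≠ 0 := fun t ht =>
    (hη.trans_le (le_add_mul_ramp hη (hpos t ht).le)).ne'
  have hnc : ContinuousOn (fun t => (t + η * ramp 2 η t)⁻¹) (spectrum ℝ a) := hmc.inv₀ hm0
  have hkc : ContinuousOn (fun t => 1 - ramp 3 η t) (spectrum ℝ a) :=
    (continuous_const.sub (continuous_ramp 3 η)).continuousOn
  have h1k : 1 - cfc (ramp 3 η) a = cfc (fun t => 1 - ramp 3 η t) a := by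
    rw [cfc_sub _ _ a, cfc_const_one ℝ a]
  refine ⟨cfc (ramp 2 η) a, cfc (ramp 3 η) a, cfc (ramp 4 η) a,
    cfc (fun t => (t + η * ramp 2 η t)⁻¹) a, cfc_predicate _ a, ?_, ?_, ?_, ?_, ?_, ?_, ?_, ?_, ?_,
    ?_, ?_⟩
  · exact norm_cfc_le zero_le_one fun t _ => abs_ramp_le_one _ _ _
  · exact norm_cfc_le zero_le_one fun t _ => abs_ramp_le_one _ _ _
  · rw [h1k]
    exact norm_cfc_le zero_le_one fun t _ => abs_le.2
      ⟨by linarith [ramp_le_one 3 η t], by linarith [ramp_nonneg 3 η t]⟩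
  · exact norm_cfc_le zero_le_one fun t _ => abs_ramp_le_one _ _ _
  · rw [← cfc_mul _ _ a (hr 2) (hr 3)]
    refine cfc_congr fun t _ => ?_
    have := ramp_mul_ramp_succ hη 2 t
    norm_num at this; exact this
  · rw [← cfc_mul _ _ a (hr 4) (hr 3)]
    refine cfc_congr fun t _ => ?_
    have := ramp_mul_ramp_succ hη 3 t
    norm_num at this; rwa [mul_comm] at this
  · rw [hm, ← cfc_mul _ _ a hmc hnc, ← cfc_const_one ℝ a]
    exact cfc_congr fun t ht => mul_inv_cancel₀ (hm0 t ht)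
  · rw [hm, ← cfc_mul _ _ a hnc hmc, ← cfc_const_one ℝ a]
    exact cfc_congr fun t ht => inv_mul_cancel₀ (hm0 t ht)
  · refine norm_cfc_le (inv_nonneg.2 hη.le) fun t ht => ?_
    have := le_add_mul_ramp hη (hpos t ht).le
    rw [Real.norm_of_nonneg (inv_nonneg.2 (hη.le.trans this))]
    exact inv_anti₀ hη this
  · rw [h1k, ← cfc_mul _ _ a hnc (hr 2),
      ← cfc_mul _ (fun t => (t + η * ramp 2 η t)⁻¹ * ramp 2 η t) a hkc (hnc.mul (hr 2)),
      ← cfc_const_zero ℝ a]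
    refine cfc_congr fun t _ => ?_
    have := ramp_mul_ramp_succ hη 2 t
    norm_num at this
    change (1 - ramp 3 η t) * (_ * ramp 2 η t) = 0
    linear_combination (-(t + η * ramp 2 η t)⁻¹) * this
  · rw [hm, ← cfc_mul _ _ a hmc (hr 4)]
    refine norm_cfc_le (by positivity) fun t ht => ?_
    have h0 := (hη.le.trans (le_add_mul_ramp hη (hpos t ht).le))
    rw [Real.norm_of_nonneg (mul_nonneg h0 (ramp_nonneg _ _ _))]
    rcases le_total t (4 * η) with h | h
    · have h1 : t + η * ramp 2 η t ≤ 5 * η := by nlinarith [ramp_le_one 2 η t]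
      nlinarith [ramp_le_one 4 η t]
    · rw [ramp_eq_zero hη h, mul_zero]; positivity

end Cutoff

section LocalPath

variable {A : Type*} [CStarAlgebra A]

theorem isUnit_one_sub_mul_comm {R : Type*} [Ring R] {a b : R} (h : IsUnit (1 - a * b)) :
    IsUnit (1 - b * a) := by
  have h1 : IsUnit (1 + -a * b) := by rwa [neg_mul, ← sub_eq_add_neg]
  simpa [← sub_eq_add_neg] using isUnit_one_add_mul_comm h1

theorem JoinedIn.segment {E : Type*} [AddCommGroup E] [TopologicalSpace E] [Module ℝ E]
    [IsTopologicalAddGroup E] [ContinuousSMul ℝ E] {s : Set E} {f : ℝ → E} (hf : Continuous f)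
    {x y : E} (h0 : f 0 = x) (h1 : f 1 = y) (h : ∀ t, 0 ≤ t → t ≤ 1 → f t ∈ s) : JoinedIn s x y :=
  JoinedIn.ofLine hf.continuousOn h0 h1 (by rintro _ ⟨t, ⟨ht0, ht1⟩, rfl⟩; exact h t ht0 ht1)

theorem NoK1Obstructions.joinedIn_add_smul [Nontrivial A] (hA : NoK1Obstructions A)
    {y h k l n m : A} {η δ R : ℝ} (hη : 0 < η) (hη1 : η ≤ 1) (hδη : 2 * δ ≤ η)
    (hδR : 2 * δ * (R + 2) ≤ η ^ 2) (hk : IsSelfAdjoint k) (hh1 : ‖h‖ ≤ 1) (hk1 : ‖k‖ ≤ 1)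
    (hk2 : ‖1 - k‖ ≤ 1) (hl1 : ‖l‖ ≤ 1) (hhk : h * k = h) (hlk : l * k = k) (hmn : m * n = 1)
    (hnm : n * m = 1) (hn : ‖n‖ ≤ η⁻¹) (hknh : (1 - k) * (n * h) = 0) (hml : ‖m * l‖ ≤ 5 * η)
    (hmR : ‖m‖ ≤ R + 1) (hy : IsUnit y) (hym : ‖y + η • h - m‖ ≤ δ) :
    JoinedIn {w | IsUnit w ∧ ‖w - y‖ ≤ 30 * η} y (y + η • h) := by
  have hδ0 : 0 ≤ δ := (norm_nonneg _).trans hym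
  obtain ⟨e, he⟩ : ∃ e, e = y + η • h - m := ⟨_, rfl⟩
  obtain ⟨z, hz⟩ : ∃ z, z = y + η • h := ⟨_, rfl⟩
  have hze : z = m + e := by rw [hz, he]; abel
  rw [← he] at hym
  rw [← hz]
  have hzy : z - y = η • h := by rw [hz]; abel
  have hzy1 : ‖z - y‖ ≤ η := by
    rw [hzy, norm_smul, Real.norm_of_nonneg hη.le]; nlinarith
  have hmu : IsUnit m := isUnit_iff_exists.2 ⟨n, hmn, hnm⟩
  have hne : ‖n * e‖ ≤ 1 / 2 := by
    refine (norm_mul_le _ _).trans ?_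
    calc ‖n‖ * ‖e‖ ≤ η⁻¹ * (η / 2) := by gcongr; linarith
      _ = 1 / 2 := by field_simp
  have hzu : IsUnit z := by
    have h1 : IsUnit (1 - -(n * e)) := isUnit_one_sub_of_norm_lt_one (by rw [norm_neg]; linarith)
    have h2 := hmu.mul h1
    rwa [sub_neg_eq_add, mul_add, mul_one, ← mul_assoc, hmn, one_mul, ← hze] at h2
  obtain ⟨z', hzz', hz'z⟩ := isUnit_iff_exists.1 hzu
  have hz'n : z' - n = -(n * e * z') := by
    have : n * (m + e) * z' = n := by rw [← hze, mul_assoc, hzz', mul_one]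
    rw [mul_add, add_mul, hnm, one_mul] at this
    calc z' - n = z' - (z' + n * e * z') := by rw [this]
      _ = -(n * e * z') := by abel
  have hz'1 : ‖z'‖ ≤ 2 * η⁻¹ := by
    have h1 : ‖z'‖ ≤ ‖n‖ + ‖n * e‖ * ‖z'‖ := by
      have : z' = n - n * e * z' := by rw [sub_eq_add_neg, ← hz'n]; abel
      calc ‖z'‖ = ‖n - n * e * z'‖ := by rw [← this]
        _ ≤ ‖n‖ + ‖n * e * z'‖ := norm_sub_le _ _
        _ ≤ _ := by gcongr; exact norm_mul_le _ _
    nlinarith [norm_nonneg z']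
  have hzR : ‖z‖ ≤ R + 2 := by
    rw [hze]; refine (norm_add_le _ _).trans ?_; linarith
  have hzl : ‖z * l‖ ≤ 6 * η := by
    rw [hze, add_mul]
    refine (norm_add_le _ _).trans ?_
    have : ‖e * l‖ ≤ δ := (norm_mul_le _ _).trans (by nlinarith [norm_nonneg e, norm_nonneg l])
    linarith
  obtain ⟨X, hX⟩ : ∃ X, X = η • z' := ⟨_, rfl⟩
  have hX2 : ‖X‖ ≤ 2 := by
    rw [hX, norm_smul, Real.norm_of_nonneg hη.le]
    calc η * ‖z'‖ ≤ η * (2 * η⁻¹) := by gcongr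
      _ = 2 := by field_simp
  have hyX : y = z * (1 - X * h) := by
    rw [mul_sub, mul_one, ← mul_assoc, hX, mul_smul_comm, hzz', smul_mul_assoc, one_mul, ← hzy]
    abel
  have hXu : IsUnit (1 - X * h) := by
    have h1 : 1 - X * h = z' * y := by rw [hyX, ← mul_assoc, hz'z, one_mul]
    rw [h1]; exact (isUnit_iff_exists.2 ⟨z, hz'z, hzz'⟩).mul hy
  have hgX : ∀ g : A, h * g = h → IsUnit (1 - g * (X * h)) := fun g hg => by
    refine isUnit_one_sub_mul_comm ?_
    rwa [mul_assoc, hg]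
  have hkXh : ‖(1 - k) * (X * h)‖ ≤ 2 * δ * η⁻¹ := by
    have h1 : (1 - k) * (X * h) = -(η • ((1 - k) * (n * e * z' * h))) := by
      have : z' = n + -(n * e * z') := by rw [← hz'n]; abel
      rw [hX, smul_mul_assoc, mul_smul_comm]
      nth_rewrite 1 [this]
      rw [add_mul, mul_add, hknh, zero_add, neg_mul, mul_neg, smul_neg]
    rw [h1, norm_neg, norm_smul, Real.norm_of_nonneg hη.le]
    have h2 : ‖(1 - k) * (n * e * z' * h)‖ ≤ 1 * (η⁻¹ * δ * (2 * η⁻¹) * 1) := by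
      refine (norm_mul_le _ _).trans (mul_le_mul hk2 ?_ (norm_nonneg _) zero_le_one)
      refine (norm_mul_le _ _).trans (mul_le_mul ?_ hh1 (norm_nonneg _) (by positivity))
      refine (norm_mul_le _ _).trans (mul_le_mul ?_ hz'1 (norm_nonneg _) (by positivity))
      exact (norm_mul_le _ _).trans (mul_le_mul hn hym (norm_nonneg _) (by positivity))
    calc _ ≤ η * (1 * (η⁻¹ * δ * (2 * η⁻¹) * 1)) := by gcongr
      _ = 2 * δ * η⁻¹ := by field_simp
  obtain ⟨M, hM⟩ : ∃ M, M = 1 - k * (X * h) := ⟨_, rfl⟩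
  have hMu : IsUnit M := hM ▸ hgX k hhk
  have hM3 : ‖M‖ ≤ 3 := by
    have h1 : ‖k * (X * h)‖ ≤ 1 * (2 * 1) :=
      (norm_mul_le _ _).trans (mul_le_mul hk1 ((norm_mul_le _ _).trans
        (mul_le_mul hX2 hh1 (norm_nonneg _) (by positivity))) (norm_nonneg _) zero_le_one)
    rw [hM]; refine (norm_sub_le _ _).trans ?_; rw [norm_one]; linarith
  have hzM : ‖z * M - y‖ ≤ η := by
    have h1 : z * M - y = z * ((1 - k) * (X * h)) := by
      rw [hyX, hM]; noncomm_ring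
    have h2 : 0 ≤ R + 2 := (norm_nonneg z).trans hzR
    rw [h1]
    refine (norm_mul_le _ _).trans ?_
    calc ‖z‖ * ‖(1 - k) * (X * h)‖ ≤ (R + 2) * (2 * δ * η⁻¹) := by gcongr
      _ = (2 * δ * (R + 2)) * η⁻¹ := by ring
      _ ≤ η ^ 2 * η⁻¹ := by gcongr
      _ = η := by field_simp
  have hlu : ∀ τ : ℝ, 0 < τ → τ ≤ 1 → IsUnit (1 - (1 - τ) • l) := fun τ h0 h1 =>
    isUnit_one_sub_of_norm_lt_one (by
      rw [norm_smul, Real.norm_of_nonneg (by linarith)]; nlinarith [norm_nonneg l])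
  have hzlτ : ∀ τ : ℝ, 0 ≤ τ → τ ≤ 1 → ‖(1 - τ) • (z * l)‖ ≤ 6 * η := fun τ h0 h1 => by
    rw [norm_smul, Real.norm_of_nonneg (by linarith)]
    nlinarith [norm_nonneg (z * l)]
  have pathA : JoinedIn {w | IsUnit w ∧ ‖w - y‖ ≤ 30 * η} y (z * M) := by
    refine JoinedIn.segment (f := fun s : ℝ => z * (1 - (k + (1 - s) • (1 - k)) * (X * h)))
      (by fun_prop) ?_ ?_ fun s h0 h1 => ⟨hzu.mul (hgX _ ?_), ?_⟩
    · simp [← hyX]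
    · simp [hM]
    · rw [mul_add, hhk, mul_smul_comm, mul_sub, hhk]; simp
    · have h2 : z * (1 - (k + (1 - s) • (1 - k)) * (X * h)) - y = s • (z * M - y) := by
        rw [hyX, hM, sub_smul, one_smul]
        simp only [mul_sub, sub_mul, add_mul, mul_add, smul_sub, smul_mul_assoc, mul_smul_comm,
          mul_one, one_mul]
        abel
      rw [h2, norm_smul, Real.norm_of_nonneg h0]
      nlinarith [norm_nonneg (z * M - y)]
  have hkl : M - 1 ∈ hereditaryClosure k hk := by
    have h1 : M - 1 = k * (-(X * h)) * k := by
      rw [hM, mul_neg, neg_mul, mul_assoc, mul_assoc, hhk]; abel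
    rw [h1]; exact mul_mul_mem_hereditaryClosure hk _
  obtain ⟨γ, hγ⟩ := hA.joinedIn_one hk hMu hkl
  obtain ⟨S, hS⟩ : ∃ S, ∀ t, ‖γ t - 1‖ ≤ S := by
    obtain ⟨S, hS⟩ := isCompact_univ.exists_bound_of_continuousOn
      (f := fun t => γ t - 1) (by fun_prop)
    exact ⟨S, fun t => hS t (Set.mem_univ t)⟩
  have hS0 : 0 ≤ S := (norm_nonneg _).trans (hS 0)
  obtain ⟨τ, hτ0, hτ1, hτ⟩ : ∃ τ : ℝ, 0 < τ ∧ τ ≤ 1 ∧ τ * (‖z‖ * S) ≤ η := by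
    refine ⟨min 1 (η / (‖z‖ * S + 1)), by positivity, min_le_left _ _, ?_⟩
    have h1 : min 1 (η / (‖z‖ * S + 1)) ≤ η / (‖z‖ * S + 1) := min_le_right _ _
    have h2 : η / (‖z‖ * S + 1) * (‖z‖ * S + 1) = η := by field_simp
    have h3 : 0 ≤ ‖z‖ * S := by positivity
    have h4 : 0 ≤ η / (‖z‖ * S + 1) := by positivity
    nlinarith
  have hcτ : ∀ s : ℝ, 0 ≤ s → s ≤ 1 → 0 < 1 - s * (1 - τ) ∧ 1 - s * (1 - τ) ≤ 1 := fun s h0 h1 =>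
    ⟨by nlinarith, by nlinarith⟩
  have pathB : JoinedIn {w | IsUnit w ∧ ‖w - y‖ ≤ 30 * η} (z * M)
      (z * (1 - (1 - τ) • l) * M) := by
    refine JoinedIn.segment (f := fun s : ℝ => z * (1 - (1 - (1 - s * (1 - τ))) • l) * M)
      (by fun_prop) (by simp) (by simp) fun s h0 h1 =>
        ⟨(hzu.mul (hlu _ (hcτ s h0 h1).1 (hcτ s h0 h1).2)).mul hMu, ?_⟩
    have h2 := hzlτ _ (hcτ s h0 h1).1.le (hcτ s h0 h1).2
    have h3 : z * (1 - (1 - (1 - s * (1 - τ))) • l) * M - y =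
        (z * M - y) - ((1 - (1 - s * (1 - τ))) • (z * l)) * M := by
      rw [mul_sub, mul_one, mul_smul_comm, sub_mul]; abel
    rw [h3]
    refine (norm_sub_le _ _).trans ?_
    have h4 := (norm_mul_le ((1 - (1 - s * (1 - τ))) • (z * l)) M).trans
      (mul_le_mul h2 hM3 (norm_nonneg _) (by positivity))
    linarith
  have pathC : JoinedIn {w | IsUnit w ∧ ‖w - y‖ ≤ 30 * η} (z * (1 - (1 - τ) • l))
      (z * (1 - (1 - τ) • l) * M) := by
    refine ⟨⟨⟨fun t => z * (1 - (1 - τ) • l) * γ t, by fun_prop⟩, by simp, by simp⟩, fun t =>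
      ⟨(hzu.mul (hlu τ hτ0 hτ1)).mul (hγ t).1, ?_⟩⟩
    have h1 := mul_eq_of_mem_hereditaryClosure hk hlk (hγ t).2
    have h2 : z * (1 - (1 - τ) • l) * γ t - y =
        (z - y) - (1 - τ) • (z * l) + τ • (z * (γ t - 1)) := by
      have h3 : l * γ t = γ t - 1 + l := by rw [← h1]; noncomm_ring
      rw [mul_assoc, sub_mul, one_mul, smul_mul_assoc, h3]
      simp only [mul_sub, sub_smul, one_smul, mul_add, smul_add, mul_smul_comm, smul_sub, mul_one]
      abel
    change ‖z * (1 - (1 - τ) • l) * γ t - y‖ ≤ _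
    rw [h2]
    refine (norm_add_le _ _).trans ?_
    have h4 := norm_sub_le (z - y) ((1 - τ) • (z * l))
    have h5 := hzlτ τ hτ0.le hτ1
    have h6 : ‖τ • (z * (γ t - 1))‖ ≤ η := by
      rw [norm_smul, Real.norm_of_nonneg hτ0.le]
      refine le_trans ?_ hτ
      gcongr
      exact (norm_mul_le _ _).trans (by gcongr; exact hS t)
    linarith
  have pathD : JoinedIn {w | IsUnit w ∧ ‖w - y‖ ≤ 30 * η} z (z * (1 - (1 - τ) • l)) := by
    refine JoinedIn.segment (f := fun s : ℝ => z * (1 - (1 - (1 - s * (1 - τ))) • l))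
      (by fun_prop) (by simp) (by simp) fun s h0 h1 =>
        ⟨hzu.mul (hlu _ (hcτ s h0 h1).1 (hcτ s h0 h1).2), ?_⟩
    have h2 := hzlτ _ (hcτ s h0 h1).1.le (hcτ s h0 h1).2
    have h3 : z * (1 - (1 - (1 - s * (1 - τ))) • l) - y =
        (z - y) - ((1 - (1 - s * (1 - τ))) • (z * l)) := by
      rw [mul_sub, mul_one, mul_smul_comm]; abel
    rw [h3]
    refine (norm_sub_le _ _).trans ?_
    linarith
  exact ((pathA.trans pathB).trans pathC.symm).trans pathD.symm

theorem NoK1Obstructions.joinedIn_of_spectrum_pos [Nontrivial A] (hA : NoK1Obstructions A)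
    {a y : A} {η δ R : ℝ} (hη : 0 < η) (hη1 : η ≤ 1) (hδη : 2 * δ ≤ η)
    (hδR : 2 * δ * (R + 2) ≤ η ^ 2) (ha : IsSelfAdjoint a) (hpos : ∀ r ∈ spectrum ℝ a, 0 < r)
    (haR : ‖a‖ ≤ R) (hy : IsUnit y) (hya : ‖y - a‖ ≤ δ) :
    JoinedIn {w | IsUnit w ∧ ‖w - a‖ ≤ 31 * η} a y := by
  obtain ⟨h, k, l, n, hk, hh1, hk1, hk2, hl1, hhk, hlk, hmn, hnm, hn, hknh, hml⟩ :=
    exists_cutoffs ha hpos hη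
  have hau : IsUnit a := by
    rw [← spectrum.zero_notMem_iff ℝ]
    exact fun h => (hpos 0 h).false
  have hδ0 : 0 ≤ δ := (norm_nonneg _).trans hya
  have hηh : ‖η • h‖ ≤ η := by
    rw [norm_smul, Real.norm_of_nonneg hη.le]; nlinarith
  have hmR : ‖a + η • h‖ ≤ R + 1 := (norm_add_le _ _).trans (by linarith)
  have h1 := hA.joinedIn_add_smul (δ := δ) hη hη1 hδη hδR hk hh1 hk1 hk2 hl1 hhk hlk hmn hnm hn
    hknh hml hmR hau (by simpa using hδ0)
  have h2 := hA.joinedIn_add_smul (δ := δ) hη hη1 hδη hδR hk hh1 hk1 hk2 hl1 hhk hlk hmn hnm hn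
    hknh hml hmR hy (by simpa using hya)
  have h3 : JoinedIn {w | IsUnit w ∧ ‖w - a‖ ≤ 31 * η} (a + η • h) (y + η • h) := by
    refine JoinedIn.segment (f := fun s : ℝ => (a + η • h) + s • (y - a)) (by fun_prop) (by simp)
      (by simp only [one_smul]; abel) fun s h0 h1 => ⟨?_, ?_⟩
    · have h4 : (a + η • h) + s • (y - a) = (a + η • h) * (1 - -(s • (n * (y - a)))) := by
        rw [sub_neg_eq_add, mul_add, mul_one, mul_smul_comm, ← mul_assoc, hmn, one_mul]
      rw [h4]
      refine (isUnit_iff_exists.2 ⟨n, hmn, hnm⟩).mul (isUnit_one_sub_of_norm_lt_one ?_)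
      have h5 : ‖n * (y - a)‖ ≤ 1 / 2 := by
        refine (norm_mul_le _ _).trans ?_
        calc ‖n‖ * ‖y - a‖ ≤ η⁻¹ * (η / 2) := by gcongr; linarith
          _ = 1 / 2 := by field_simp
      rw [norm_neg, norm_smul, Real.norm_of_nonneg h0]
      nlinarith [norm_nonneg (n * (y - a))]
    · have h4 : (a + η • h) + s • (y - a) - a = η • h + s • (y - a) := by abel
      rw [h4]
      refine (norm_add_le _ _).trans ?_
      rw [norm_smul s, Real.norm_of_nonneg h0]
      nlinarith [norm_nonneg (y - a)]
  refine ((h1.mono ?_).trans h3).trans (h2.symm.mono ?_)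
  · exact fun w hw => ⟨hw.1, hw.2.trans (by linarith)⟩
  · refine fun w hw => ⟨hw.1, ?_⟩
    have h4 : w - a = (w - y) + (y - a) := by abel
    rw [h4]
    refine (norm_add_le _ _).trans ?_
    linarith [hw.2]

theorem NoK1Obstructions.exists_joinedIn (hA : NoK1Obstructions A) (R : ℝ) {ε : ℝ} (hε : 0 < ε) :
    ∃ δ > 0, ∀ x y : A, IsUnit x → IsUnit y → ‖x‖ ≤ R → ‖y - x‖ ≤ δ →
      JoinedIn {w | IsUnit w ∧ ‖w - x‖ ≤ ε} x y := by
  cases subsingleton_or_nontrivial A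
  · exact ⟨1, one_pos, fun x y hx _ _ _ => by
      rw [Subsingleton.elim y x]
      exact JoinedIn.refl ⟨hx, by simpa using hε.le⟩⟩
  obtain ⟨η, hη, hη1, hηε⟩ : ∃ η : ℝ, 0 < η ∧ η ≤ 1 ∧ 31 * η ≤ ε :=
    ⟨min 1 (ε / 31), by positivity, min_le_left _ _, by linarith [min_le_right 1 (ε / 31)]⟩
  have hR : 0 ≤ |R| := abs_nonneg R
  obtain ⟨δ, hδ, hδη, hδR⟩ : ∃ δ : ℝ, 0 < δ ∧ 2 * δ ≤ η ∧ 2 * δ * (|R| + 2) ≤ η ^ 2 := by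
    refine ⟨min (η / 2) (η ^ 2 / (2 * (|R| + 2))), by positivity,
      by linarith [min_le_left (η / 2) (η ^ 2 / (2 * (|R| + 2)))], ?_⟩
    have h1 := min_le_right (η / 2) (η ^ 2 / (2 * (|R| + 2)))
    rw [le_div_iff₀ (by positivity)] at h1
    linarith
  refine ⟨δ, hδ, fun x y hx hy hxR hxy => ?_⟩
  obtain ⟨v, hv, p, hps, hpp, rfl⟩ := exists_unitary_mul_of_isUnit hx
  have hvs : star v * v = 1 := Unitary.star_mul_self_of_mem hv
  have hvs' : v * star v = 1 := Unitary.mul_star_self_of_mem hv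
  have hvu : IsUnit v := isUnit_iff_exists.2 ⟨star v, hvs', hvs⟩
  have h1 : ‖star v * y - p‖ ≤ δ := by
    have h2 : star v * y - p = star v * (y - v * p) := by rw [mul_sub, ← mul_assoc, hvs, one_mul]
    rw [h2, CStarRing.norm_mem_unitary_mul _ (Unitary.star_mem hv)]
    exact hxy
  have h2 : ‖p‖ ≤ |R| := by
    rw [CStarRing.norm_mem_unitary_mul _ hv] at hxR
    exact hxR.trans (le_abs_self R)
  have h3 := (hA.joinedIn_of_spectrum_pos hη hη1 hδη hδR hps hpp h2
    (hvu.star.mul hy) h1).map_of_continuous (f := fun w => v * w) (by fun_prop)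
    (t := {w | IsUnit w ∧ ‖w - v * p‖ ≤ ε}) fun w hw => ⟨hvu.mul hw.1, by
      rw [← mul_sub, CStarRing.norm_mem_unitary_mul _ hv]
      exact hw.2.trans hηε⟩
  simpa [← mul_assoc, hvs'] using h3

end LocalPath

section ContinuousFamilies

variable {A : Type*} [CStarAlgebra A]

theorem NoK1Obstructions.exists_unit_path_near (hA : NoK1Obstructions A) {F : ℝ → A}
    (hF : UniformContinuous F) {R : ℝ} (hFR : ∀ t, ‖F t‖ ≤ R) {ε : ℝ} (hε : 0 < ε) :
    ∃ g : ℝ → A, Continuous g ∧ (∀ t, IsUnit (g t)) ∧ ∀ t, 0 ≤ t → t ≤ 1 → ‖g t - F t‖ ≤ ε := by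
  obtain ⟨δ, hδ, hpath⟩ := hA.exists_joinedIn (R + 1) (half_pos hε)
  obtain ⟨c, hc, hcδ, hcε, hc1⟩ : ∃ c : ℝ, 0 < c ∧ 3 * c ≤ δ ∧ 4 * c ≤ ε ∧ c ≤ 1 :=
    ⟨min (δ / 3) (min (ε / 4) 1), by positivity, by linarith [min_le_left (δ / 3) (min (ε / 4) 1)],
      by linarith [(min_le_right (δ / 3) (min (ε / 4) 1)).trans (min_le_left _ _)],
      (min_le_right _ _).trans (min_le_right _ _)⟩
  obtain ⟨ρ, hρ, hFρ⟩ := Metric.uniformContinuous_iff.1 hF c hc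
  obtain ⟨n, hn⟩ := exists_nat_one_div_lt hρ
  have hn0 : (0 : ℝ) < n + 1 := by positivity
  have hx : ∀ i : ℕ, ∃ x : A, IsUnit x ∧ ‖x - F (i / (n + 1))‖ < c := fun i => by
    obtain ⟨x, hx, hxF⟩ := hA.1.dense_isUnit.exists_dist_lt (F (i / (n + 1))) hc
    exact ⟨x, hx, by rwa [dist_comm, dist_eq_norm] at hxF⟩
  choose x hxu hxF using hx
  have hFF : ∀ s t : ℝ, |s - t| ≤ 1 / (n + 1) → ‖F s - F t‖ < c := fun s t h => by
    rw [← dist_eq_norm]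
    exact hFρ (by rw [Real.dist_eq]; exact h.trans_lt hn)
  have key : ∀ i : ℕ, ∃ g : ℝ → A, Continuous g ∧ (∀ t, IsUnit (g t)) ∧
      (∀ t : ℝ, 0 ≤ t → t ≤ i / (n + 1) → ‖g t - F t‖ ≤ ε) ∧ g (i / (n + 1)) = x i := by
    intro i
    induction i with
    | zero =>
      refine ⟨fun _ => x 0, continuous_const, fun _ => hxu 0, fun t h0 h1 => ?_, rfl⟩
      have ht : t = ((0 : ℕ) : ℝ) / (n + 1) := by
        rw [Nat.cast_zero, zero_div] at h1 ⊢; exact le_antisymm h1 h0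
      rw [ht]; linarith [hxF 0]
    | succ i ih =>
      obtain ⟨g, hgc, hgu, hgF, hgi⟩ := ih
      have hstep : ((i + 1 : ℕ) : ℝ) / (n + 1) = i / (n + 1) + 1 / (n + 1) := by
        push_cast; ring
      have hxx : ‖x (i + 1) - x i‖ ≤ δ := by
        have h1 := hFF (((i + 1 : ℕ) : ℝ) / (n + 1)) (i / (n + 1)) (by
          rw [hstep, add_sub_cancel_left, abs_of_pos (by positivity)])
        have h2 : x (i + 1) - x i = (x (i + 1) - F (((i + 1 : ℕ) : ℝ) / (n + 1))) +
            (F (((i + 1 : ℕ) : ℝ) / (n + 1)) - F (i / (n + 1))) - (x i - F (i / (n + 1))) := by abel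
        rw [h2]
        refine (norm_sub_le _ _).trans ?_
        have h3 := norm_add_le (x (i + 1) - F (((i + 1 : ℕ) : ℝ) / (n + 1)))
          (F (((i + 1 : ℕ) : ℝ) / (n + 1)) - F (i / (n + 1)))
        linarith [hxF i, hxF (i + 1)]
      have hxR : ‖x i‖ ≤ R + 1 := by
        have h2 := norm_add_le (F (i / (n + 1))) (x i - F (i / (n + 1)))
        rw [add_sub_cancel] at h2
        linarith [hxF i, hFR (i / (n + 1))]
      obtain ⟨γ, hγ⟩ := hpath (x i) (x (i + 1)) (hxu i) (hxu (i + 1)) hxR hxx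
      have hγ' : ∀ s, IsUnit (γ.extend s) ∧ ‖γ.extend s - x i‖ ≤ ε / 2 := fun s => hγ _
      refine ⟨fun t : ℝ => if t ≤ i / (n + 1) then g t else γ.extend ((n + 1) * t - i),
        ?_, ?_, ?_, ?_⟩
      · refine Continuous.if_le hgc (γ.continuous_extend.comp (by fun_prop)) continuous_id
          continuous_const fun t ht => ?_
        rw [ht, hgi, mul_div_cancel₀ _ hn0.ne', sub_self, Path.extend_zero]
      · intro t
        dsimp only
        split_ifs
        exacts [hgu t, (hγ' _).1]
      · intro t h0 h1
        dsimp only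
        split_ifs with h
        · exact hgF t h0 h
        · have h2 := hFF (i / (n + 1)) t (by
            rw [abs_sub_comm, abs_of_pos (by linarith)]; linarith)
          have h3 : γ.extend ((n + 1) * t - i) - F t = (γ.extend ((n + 1) * t - i) - x i) +
              (x i - F (i / (n + 1))) + (F (i / (n + 1)) - F t) := by abel
          rw [h3]
          refine (norm_add₃_le).trans ?_
          linarith [(hγ' ((n + 1) * t - i)).2, hxF i]
      · have h1 : ¬ ((i + 1 : ℕ) : ℝ) / (n + 1) ≤ i / (n + 1) := by
          rw [hstep, not_le]
          have : (0 : ℝ) < 1 / (n + 1) := by positivity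
          linarith
        have h2 : (n + 1) * (((i + 1 : ℕ) : ℝ) / (n + 1)) - i = 1 := by
          rw [mul_div_cancel₀ _ hn0.ne']; push_cast; ring
        dsimp only
        rw [if_neg h1, h2, Path.extend_one]
  obtain ⟨g, hgc, hgu, hgF, -⟩ := key (n + 1)
  refine ⟨g, hgc, hgu, fun t h0 h1 => hgF t h0 (h1.trans_eq ?_)⟩
  push_cast
  rw [div_self hn0.ne']

theorem NoK1Obstructions.dense_isUnit_continuousMap (hA : NoK1Obstructions A) :
    Dense {f : C(unitInterval, A) | IsUnit f} := by
  intro f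
  rw [Metric.mem_closure_iff]
  intro ε hε
  have hF : UniformContinuous (Set.IccExtend zero_le_one f : ℝ → A) :=
    (CompactSpace.uniformContinuous_of_continuous f.continuous).comp
      (LipschitzWith.projIcc zero_le_one).uniformContinuous
  obtain ⟨g, hgc, hgu, hg⟩ := hA.exists_unit_path_near hF
    (fun t => f.norm_coe_le_norm _) (half_pos hε)
  refine ⟨⟨fun t => g t, by fun_prop⟩, ?_, ?_⟩
  · exact (ContinuousMap.isUnit_iff_forall_isUnit _).2 fun t => hgu t
  · refine lt_of_le_of_lt ((ContinuousMap.dist_le (half_pos hε).le).2 fun t => ?_) (half_lt_self hε)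
    have h1 := hg t t.2.1 t.2.2
    rw [dist_comm, dist_eq_norm]
    simpa using h1

end ContinuousFamilies

section Endpoints

/-- The affine path from `x` to `y`. -/
def affinePath {D : Type*} [AddCommGroup D] [Module ℝ D] [TopologicalSpace D] [ContinuousAdd D]
    [ContinuousSMul ℝ D] (x : D × D) : C(unitInterval, D) :=
  ⟨fun t => (1 - (t : ℝ)) • x.1 + (t : ℝ) • x.2, by fun_prop⟩

theorem continuous_affinePath {D : Type*} [AddCommGroup D] [Module ℝ D] [TopologicalSpace D]
    [ContinuousAdd D] [ContinuousSMul ℝ D] : Continuous (affinePath (D := D)) := by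
  refine ContinuousMap.continuous_of_continuous_uncurry _ ?_
  change Continuous fun x : (D × D) × unitInterval =>
    (1 - (x.2 : ℝ)) • x.1.1 + (x.2 : ℝ) • x.1.2
  fun_prop

open Topology Filter in
theorem exists_isUnit_eq_endpoints {D : Type*} [NormedRing D] [NormedAlgebra ℝ D] [CompleteSpace D]
    (hd : Dense {g : C(unitInterval, D) | IsUnit g}) {f : C(unitInterval, D)} (h0 : IsUnit (f 0))
    (h1 : IsUnit (f 1)) {U : Set C(unitInterval, D)} (hU : U ∈ 𝓝 f) :
    ∃ g ∈ U, IsUnit g ∧ g 0 = f 0 ∧ g 1 = f 1 := by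
  let P : C(unitInterval, D) → C(unitInterval, D) := fun g =>
    affinePath (Ring.inverse (g 0) * f 0, Ring.inverse (g 1) * f 1)
  have hev : ∀ t : unitInterval, IsUnit (f t) →
      Tendsto (fun g : C(unitInterval, D) => Ring.inverse (g t) * f t) (𝓝 f) (𝓝 1) := by
    rintro t ⟨u, hu⟩
    have h2 := NormedRing.inverse_continuousAt u
    rw [hu] at h2
    have h3 : Tendsto (fun g : C(unitInterval, D) => g t) (𝓝 f) (𝓝 (f t)) :=
      (continuous_eval_const t).tendsto f
    have h4 := (h2.tendsto.comp h3).mul_const (f t)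
    rwa [Ring.inverse_mul_cancel _ ⟨u, hu⟩] at h4
  have hP1 : affinePath ((1, 1) : D × D) = 1 := by
    ext t
    simp [affinePath, ← add_smul]
  have hP : Tendsto P (𝓝 f) (𝓝 1) := by
    have h2 := (continuous_affinePath (D := D)).tendsto (1, 1)
    rw [hP1] at h2
    exact h2.comp ((hev 0 h0).prodMk_nhds (hev 1 h1))
  have hgP : Tendsto (fun g => g * P g) (𝓝 f) (𝓝 f) := by
    simpa using tendsto_id.mul hP
  have hPu : ∀ᶠ g in 𝓝 f, IsUnit (P g) := hP.eventually (Units.isOpen.mem_nhds isUnit_one)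
  obtain ⟨g, hg, hgU, hgu⟩ := hd.inter_nhds_nonempty ((hgP.eventually hU).and hPu)
  have hgt : ∀ t, IsUnit (g t) := (ContinuousMap.isUnit_iff_forall_isUnit g).1 hg
  refine ⟨g * P g, hgU, IsUnit.mul hg hgu, ?_, ?_⟩
  · simp [P, affinePath, ← mul_assoc, Ring.mul_inverse_cancel _ (hgt 0)]
  · simp [P, affinePath, ← mul_assoc, Ring.mul_inverse_cancel _ (hgt 1)]

open Topology in
theorem Matrix.exists_isUnit_eq_endpoints {ι A : Type*} [Fintype ι] [DecidableEq ι] [CStarAlgebra A]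
    (hd : Dense {g : C(unitInterval, Matrix ι ι A) | IsUnit g}) {f : C(unitInterval, Matrix ι ι A)}
    (h0 : IsUnit (f 0)) (h1 : IsUnit (f 1)) {U : Set C(unitInterval, Matrix ι ι A)}
    (hU : U ∈ 𝓝 f) : ∃ g ∈ U, IsUnit g ∧ g 0 = f 0 ∧ g 1 = f 1 := by
  let nr : NormedRing (Matrix ι ι A) := Matrix.linftyOpNormedRing
  let na : NormedAlgebra ℝ (Matrix ι ι A) := Matrix.linftyOpNormedAlgebra
  have hcs : @CompleteSpace (Matrix ι ι A) nr.toMetricSpace.toUniformSpace :=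
    Matrix.instCompleteSpace _ _ A
  exact @_root_.exists_isUnit_eq_endpoints _ nr na hcs hd f h0 h1 U hU

/-- A matrix of functions regarded as a function with matrix values. -/
def matrixFunction (ι A : Type*) [Fintype ι] [DecidableEq ι] [CStarAlgebra A] :
    Matrix ι ι C(unitInterval, A) →+* C(unitInterval, Matrix ι ι A) where
  toFun F := ⟨fun t => Matrix.of fun i j => F i j t,
    continuous_matrix fun i j => (F i j).continuous⟩
  map_one' := by ext t i j; by_cases h : i = j <;> simp [Matrix.one_apply, h]
  map_mul' F G := by ext t i j; simp [Matrix.mul_apply]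
  map_zero' := by ext t i j; simp
  map_add' F G := by ext t i j; simp

theorem NoK1Obstructions.dense_isUnit_continuousMap_matrix {A : Type*} [CStarAlgebra A]
    (hA : NoK1Obstructions A) (ι : Type*) [Fintype ι] [DecidableEq ι] :
    Dense {f : C(unitInterval, Matrix ι ι A) | IsUnit f} := by
  have hc : Continuous (matrixFunction ι A) := by
    refine ContinuousMap.continuous_of_continuous_uncurry _ (continuous_matrix fun i j => ?_)
    change Continuous fun x : Matrix ι ι C(unitInterval, A) × unitInterval => x.1 i j x.2
    exact continuous_eval.comp ((continuous_fst.matrix_elem i j).prodMk continuous_snd)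
  have hs : Function.Surjective (matrixFunction ι A) := fun f =>
    ⟨Matrix.of fun i j => ⟨fun t => f t i j, f.continuous.matrix_elem i j⟩, rfl⟩
  have hd : Dense {F : Matrix ι ι C(unitInterval, A) | IsUnit F} :=
    Matrix.dense_isUnit hA.dense_isUnit_continuousMap
  refine (hs.denseRange.dense_image hc hd).mono ?_
  rintro _ ⟨F, hF, rfl⟩
  exact hF.map (matrixFunction ι A)

/-- The embedding `b ↦ 1 ⊗ b`. -/
def oneTensor (p q : ℕ) (A : Type*) [Ring A] :
    Matrix (Fin q) (Fin q) A →+* Matrix (Fin p × Fin q) (Fin p × Fin q) A :=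
  (Matrix.compRingEquiv (Fin p) (Fin q) A).toRingHom.comp (Matrix.scalar (Fin p))

/-- The embedding `a ↦ a ⊗ 1`. -/
def tensorOne (p q : ℕ) (A : Type*) [Ring A] :
    Matrix (Fin p) (Fin p) A →+* Matrix (Fin p × Fin q) (Fin p × Fin q) A :=
  (Matrix.compRingEquiv (Fin p) (Fin q) A).toRingHom.comp (Matrix.scalar (Fin q)).mapMatrix

theorem oneTensor_apply {p q : ℕ} {A : Type*} [Ring A] (b : Matrix (Fin q) (Fin q) A)
    (x y : Fin p × Fin q) : oneTensor p q A b x y = if x.1 = y.1 then b x.2 y.2 else 0 := by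
  change Matrix.diagonal (fun _ => b) x.1 y.1 x.2 y.2 = _
  rw [Matrix.diagonal_apply]
  split_ifs <;> rfl

theorem tensorOne_apply {p q : ℕ} {A : Type*} [Ring A] (a : Matrix (Fin p) (Fin p) A)
    (x y : Fin p × Fin q) : tensorOne p q A a x y = if x.2 = y.2 then a x.1 y.1 else 0 := by
  change Matrix.diagonal (fun _ => a x.1 y.1) x.2 y.2 = _
  rw [Matrix.diagonal_apply]

theorem continuous_oneTensor (p q : ℕ) (A : Type*) [Ring A] [TopologicalSpace A] :
    Continuous (oneTensor p q A) := by
  refine continuous_matrix fun x y => ?_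
  simp only [oneTensor_apply]
  split_ifs
  · exact continuous_id.matrix_elem _ _
  · exact continuous_const

theorem continuous_tensorOne (p q : ℕ) (A : Type*) [Ring A] [TopologicalSpace A] :
    Continuous (tensorOne p q A) := by
  refine continuous_matrix fun x y => ?_
  simp only [tensorOne_apply]
  split_ifs
  · exact continuous_id.matrix_elem _ _
  · exact continuous_const

variable {p q : ℕ} {A : Type*} [CStarAlgebra A]

theorem dimDropCond_iff {f : C(unitInterval, Matrix (Fin p × Fin q) (Fin p × Fin q) A)} :
    DimDropCond p q A f ↔ (∃ b, f 0 = oneTensor p q A b) ∧ ∃ a, f 1 = tensorOne p q A a := by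
  refine and_congr (exists_congr fun b => ?_) (exists_congr fun a => ?_)
  · refine ⟨fun h => Matrix.ext ?_, fun h i i' j j' => by rw [h, oneTensor_apply]⟩
    rintro ⟨i, j⟩ ⟨i', j'⟩
    rw [h, oneTensor_apply]
  · refine ⟨fun h => Matrix.ext ?_, fun h i i' j j' => by rw [h, tensorOne_apply]⟩
    rintro ⟨i, j⟩ ⟨i', j'⟩
    rw [h, tensorOne_apply]

open Topology in
theorem NoK1Obstructions.exists_isUnit_dimDropCond (hA : NoK1Obstructions A)
    {f : C(unitInterval, Matrix (Fin p × Fin q) (Fin p × Fin q) A)} (hf : DimDropCond p q A f)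
    {U : Set C(unitInterval, Matrix (Fin p × Fin q) (Fin p × Fin q) A)} (hU : U ∈ 𝓝 f) :
    ∃ g ∈ U, DimDropCond p q A g ∧ ∃ g', DimDropCond p q A g' ∧ g * g' = 1 ∧ g' * g = 1 := by
  obtain ⟨⟨b, hb⟩, a, ha⟩ := dimDropCond_iff.1 hf
  let T : Matrix (Fin q) (Fin q) A × Matrix (Fin p) (Fin p) A →
      C(unitInterval, Matrix (Fin p × Fin q) (Fin p × Fin q) A) := fun c =>
    f + affinePath (oneTensor p q A c.1 - f 0, tensorOne p q A c.2 - f 1)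
  have hT : Continuous T := by
    refine continuous_const.add (continuous_affinePath.comp (Continuous.prodMk ?_ ?_))
    · exact ((continuous_oneTensor p q A).comp continuous_fst).sub continuous_const
    · exact ((continuous_tensorOne p q A).comp continuous_snd).sub continuous_const
  have hT1 : T (b, a) = f := by
    ext t : 1
    simp [T, affinePath, hb, ha]
  have hT0 : ∀ c, T c 0 = oneTensor p q A c.1 := fun c => by simp [T, affinePath]
  have hT1' : ∀ c, T c 1 = tensorOne p q A c.2 := fun c => by simp [T, affinePath]
  have hev : ∀ᶠ c in 𝓝 (b, a), U ∈ 𝓝 (T c) := by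
    have h2 := hT.tendsto (b, a)
    rw [hT1] at h2
    exact h2.eventually (eventually_mem_nhds_iff.2 hU)
  obtain ⟨⟨_, _⟩, ⟨⟨b', rfl⟩, ⟨a', rfl⟩⟩, hc⟩ := ((Matrix.dense_isUnit hA.1.dense_isUnit).prod
    (Matrix.dense_isUnit hA.1.dense_isUnit)).inter_nhds_nonempty hev
  obtain ⟨g, hgU, hgu, hg0, hg1⟩ := Matrix.exists_isUnit_eq_endpoints
    (hA.dense_isUnit_continuousMap_matrix _) (by rw [hT0]; exact b'.isUnit.map _)
    (by rw [hT1']; exact a'.isUnit.map _) hc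
  rw [hT0] at hg0
  rw [hT1'] at hg1
  obtain ⟨g', h1, h2⟩ := isUnit_iff_exists.1 hgu
  refine ⟨g, hgU, dimDropCond_iff.2 ⟨⟨_, hg0⟩, ⟨_, hg1⟩⟩, g',
    dimDropCond_iff.2 ⟨⟨b'⁻¹.1, ?_⟩, ⟨a'⁻¹.1, ?_⟩⟩, h1, h2⟩
  · have h3 : g' 0 * oneTensor p q A b' = 1 := by rw [← hg0]; exact DFunLike.congr_fun h2 0
    exact left_inv_eq_right_inv h3 (by rw [← map_mul, Units.mul_inv, map_one])
  · have h3 : g' 1 * tensorOne p q A a' = 1 := by rw [← hg1]; exact DFunLike.congr_fun h2 1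
    exact left_inv_eq_right_inv h3 (by rw [← map_mul, Units.mul_inv, map_one])

end Endpoints

/-- `Z_{p,q}(A)` is a unital C*-algebra; stable rank one for it means exactly that its
invertible elements are dense. -/
theorem stmt9 (p q : ℕ) (hp : 1 ≤ p) (hq : 1 ≤ q) (hpq : Nat.Coprime p q)
    (A : Type*) [CStarAlgebra A] (hA : NoK1Obstructions A) :
    Dense {f : {f : C(unitInterval, Matrix (Fin p × Fin q) (Fin p × Fin q) A) //
        DimDropCond p q A f} |
      ∃ g : C(unitInterval, Matrix (Fin p × Fin q) (Fin p × Fin q) A),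
        DimDropCond p q A g ∧ f.1 * g = 1 ∧ g * f.1 = 1} := by
  intro f
  rw [mem_closure_iff_nhds]
  intro U hU
  obtain ⟨V, hV, hVU⟩ := mem_nhds_subtype _ _ _ |>.1 hU
  obtain ⟨g, hgV, hg, g', hg', h1, h2⟩ := hA.exists_isUnit_dimDropCond f.2 hV
  exact ⟨⟨g, hg⟩, hVU hgV, g', hg', h1, h2⟩
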